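/- arXiv:1706.08506 — 2 statements merged into one kernel-verified Lean document; each statement's English description precedes it below -/
import Mathlib

section
/- (Constantin–E–Titi recovered from the constant-density case.) Let N ∈ {2,3}, T > 0, and let u be a weak solution of the homogeneous incompressible Euler equations on (0,T)×T^N with divergence-free initial datum u₀ ∈ L²(T^N; ℝ^N). Assume u ∈ L^∞(0,T; L²(T^N; ℝ^N)) ∩ L³(0,T; B^{α,∞}_3(T^N; ℝ^N)) for some α > 1/3. Then for almost every t ∈ (0,T), ∫_{T^N} |u(t,x)|² dx = ∫_{T^N} |u₀(x)|² dx. -/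
open MeasureTheory ENNReal
open scoped BigOperators

noncomputable section

/-- Fundamental domain of the torus `(ℝ/ℤ)^n`, viewed inside `ℝ^n`. -/
def Box (n : ℕ) : Set (Fin n → ℝ) := Set.univ.pi fun _ => Set.Ico (0 : ℝ) 1

/-- The measure on the torus `(ℝ/ℤ)^n`, encoded as Lebesgue measure on a fundamental domain. -/
def μT (n : ℕ) : Measure (Fin n → ℝ) := volume.restrict (Box n)

/-- `ℤ^n`-periodicity: the encoding of "function on the torus `(ℝ/ℤ)^n`". -/
def ZPeriodic {n : ℕ} {E : Type*} (f : (Fin n → ℝ) → E) : Prop :=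
  ∀ (x : Fin n → ℝ) (k : Fin n → ℤ), f (x + fun i => (k i : ℝ)) = f x

/-- `i`-th partial derivative. -/
def pd {n : ℕ} {E : Type*} [NormedAddCommGroup E] [NormedSpace ℝ E]
    (i : Fin n) (f : (Fin n → ℝ) → E) (x : Fin n → ℝ) : E :=
  fderiv ℝ f x (Pi.single i 1)

/-- The Besov `B^{α,∞}_p` norm on the torus. -/
def besovNorm {n : ℕ} {E : Type*} [NormedAddCommGroup E]
    (α : ℝ) (p : ℝ≥0∞) (w : (Fin n → ℝ) → E) : ℝ≥0∞ :=
  eLpNorm w p (μT n) +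
    ⨆ ξ : {ξ : Fin n → ℝ // ξ ≠ 0},
      eLpNorm (fun x => w (x + ξ.1) - w x) p (μT n) / ENNReal.ofReal (‖ξ.1‖ ^ α)

/-- The `L^r` norm (w.r.t. `μ`) of an `ℝ≥0∞`-valued function. -/
def lpNormENN {ι : Type*} [MeasurableSpace ι] (r : ℝ≥0∞) (μ : Measure ι) (F : ι → ℝ≥0∞) : ℝ≥0∞ :=
  if r = 0 then 0
  else if r = ∞ then essSup F μ
  else (∫⁻ t, F t ^ r.toReal ∂μ) ^ (1 / r.toReal)

/-- Standard mollifier assumptions on `η`. -/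
structure IsMollifier {n : ℕ} (η : (Fin n → ℝ) → ℝ) : Prop where
  smooth : ContDiff ℝ (⊤ : ℕ∞) η
  even : ∀ x, η (-x) = η x
  nonneg : ∀ x, 0 ≤ η x
  supp : ∀ x, 1 < ‖x‖ → η x = 0
  integral_one : ∫ x, η x = 1

/-- Mollification `f^ε = η_ε * f` (spatial variable). For a `ℤ^n`-periodic `f` this is
the mollification on the torus. -/
def mollify {n : ℕ} {E : Type*} [NormedAddCommGroup E] [NormedSpace ℝ E]
    (η : (Fin n → ℝ) → ℝ) (ε : ℝ) (f : (Fin n → ℝ) → E) (x : Fin n → ℝ) : E :=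
  ∫ y : Fin n → ℝ, ((ε ^ n)⁻¹ * η (ε⁻¹ • y)) • f (x - y)


/-- Weak solution of the homogeneous incompressible Euler equations on `(0,T) × T^N`
with initial datum `u₀` (spatial functions encoded as `ℤ^N`-periodic functions on `ℝ^N`). -/
structure IsWeakSolutionHomEuler (N : ℕ) (T : ℝ)
    (u : ℝ → (Fin N → ℝ) → (Fin N → ℝ)) (u₀ : (Fin N → ℝ) → (Fin N → ℝ)) : Prop where
  u_meas : Measurable (Function.uncurry u)
  u₀_meas : Measurable u₀
  u_per : ∀ t, ZPeriodic (u t)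
  u₀_per : ZPeriodic u₀
  /-- `|u|² ∈ L^∞(0,T; L¹(T^N))` -/
  energy_bdd : lpNormENN ∞ (volume.restrict (Set.Ioo 0 T))
      (fun t => ∫⁻ x in Box N, ENNReal.ofReal (∑ i, (u t x i)^2)) < ∞
  /-- weak form of the momentum equation `u_t + div(u⊗u) + ∇P = 0`, `u|_{t=0} = u₀`,
  tested with divergence-free fields -/
  momentum : ∀ Φ : ℝ → (Fin N → ℝ) → (Fin N → ℝ),
    ContDiff ℝ (⊤ : ℕ∞) (Function.uncurry Φ) → (∀ t, ZPeriodic (Φ t)) →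
    (∃ T', T' < T ∧ ∀ t ≥ T', ∀ x, Φ t x = 0) →
    (∀ t x, ∑ i, pd i (Φ t) x i = 0) →
    (∫ t in Set.Ioo 0 T, ∫ x in Box N,
        ((∑ i, u t x i * deriv (fun s => Φ s x i) t)
          + ∑ i, ∑ j, u t x i * u t x j * pd j (fun y => Φ t y i) x))
      + ∫ x in Box N, (∑ i, u₀ x i * Φ 0 x i) = 0
  /-- weak form of `div u = 0` -/
  div_free : ∀ᵐ t ∂(volume.restrict (Set.Ioo 0 T)), ∀ φ : (Fin N → ℝ) → ℝ,
    ContDiff ℝ (⊤ : ℕ∞) φ → ZPeriodic φ → ∫ x in Box N, (∑ i, u t x i * pd i φ x) = 0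

section Torus

variable {n : ℕ}

lemma measurableSet_box : MeasurableSet (Box n) :=
  MeasurableSet.univ_pi fun _ => measurableSet_Ico

lemma muT_eq_pi : μT n = Measure.pi fun _ => (volume : Measure ℝ).restrict (Set.Ico 0 1) := by
  unfold μT Box
  rw [volume_pi, Measure.restrict_pi_pi]

instance isProbabilityMeasure_muT : IsProbabilityMeasure (μT n) := by
  constructor
  simp [μT, Box, Real.volume_pi_Ico]

lemma isAddFundamentalDomain_box :
    IsAddFundamentalDomain (Submodule.span ℤ (Set.range (Pi.basisFun ℝ (Fin n)))).toAddSubgroup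
      (Box n) volume := by
  have := ZSpan.isAddFundamentalDomain' (Pi.basisFun ℝ (Fin n)) volume
  rwa [ZSpan.fundamentalDomain_pi_basisFun] at this

lemma ZPeriodic.vadd_eq {E : Type*} {f : (Fin n → ℝ) → E} (hf : ZPeriodic f)
    (g : (Submodule.span ℤ (Set.range (Pi.basisFun ℝ (Fin n)))).toAddSubgroup) (x : Fin n → ℝ) :
    f (g +ᵥ x) = f x := by
  obtain ⟨g, hg⟩ := g
  rw [Submodule.mem_toAddSubgroup, Module.Basis.mem_span_iff_repr_mem] at hg
  choose k hk using hg
  have : (⟨g, by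
      rw [Submodule.mem_toAddSubgroup, Module.Basis.mem_span_iff_repr_mem]
      exact fun i => ⟨k i, hk i⟩⟩ :
      (Submodule.span ℤ (Set.range (Pi.basisFun ℝ (Fin n)))).toAddSubgroup) +ᵥ x =
        x + fun i => (k i : ℝ) := by
    ext i
    have := hk i
    simp at this
    simp [AddSubgroup.vadd_def, this, add_comm]
  rw [this, hf]

open scoped Pointwise in
lemma isAddFundamentalDomain_box_translate (a : Fin n → ℝ) :
    IsAddFundamentalDomain (Submodule.span ℤ (Set.range (Pi.basisFun ℝ (Fin n)))).toAddSubgroup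
      ((fun x => x + a) '' Box n) volume := by
  have h := (isAddFundamentalDomain_box (n := n)).vadd_of_comm a
  have h2 : a +ᵥ Box n = (fun x => x + a) '' Box n := by
    ext x
    simp only [Set.mem_vadd_set, Set.mem_image, vadd_eq_add, add_comm]
  rwa [h2] at h

instance countable_lattice :
    Countable (Submodule.span ℤ (Set.range (Pi.basisFun ℝ (Fin n)))).toAddSubgroup :=
  inferInstanceAs (Countable (Submodule.span ℤ (Set.range (Pi.basisFun ℝ (Fin n)))))

lemma ZPeriodic.lintegral_add_right {f : (Fin n → ℝ) → ℝ≥0∞} (hf : ZPeriodic f) (a : Fin n → ℝ) :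
    ∫⁻ x, f (x + a) ∂μT n = ∫⁻ x, f x ∂μT n := by
  have h1 := (measurePreserving_add_right (volume : Measure (Fin n → ℝ)) a).setLIntegral_comp_emb
    (measurableEmbedding_addRight a) f (Box n)
  unfold μT
  rw [h1]
  exact (isAddFundamentalDomain_box_translate a).setLIntegral_eq isAddFundamentalDomain_box f
    hf.vadd_eq

lemma ZPeriodic.integral_add_right {f : (Fin n → ℝ) → ℝ} (hf : ZPeriodic f) (a : Fin n → ℝ) :
    ∫ x, f (x + a) ∂μT n = ∫ x, f x ∂μT n := by
  have h1 := (measurePreserving_add_right (volume : Measure (Fin n → ℝ)) a).setIntegral_image_emb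
    (measurableEmbedding_addRight a) f (Box n)
  unfold μT
  rw [← h1]
  exact (isAddFundamentalDomain_box_translate a).setIntegral_eq isAddFundamentalDomain_box
    hf.vadd_eq

lemma lintegral_lintegral_sub_eq {W : (Fin n → ℝ) → ℝ≥0∞} {f : (Fin n → ℝ) → (Fin n → ℝ)}
    (hW : Measurable W) (hWp : ZPeriodic W) (hf : Measurable f) (hfp : ZPeriodic f) (p : ℕ) :
    ∫⁻ z, W (z.1 - z.2) * ‖f z.1 - f z.2‖ₑ ^ p ∂(μT n).prod (μT n) =
      ∫⁻ ξ, W ξ * ∫⁻ x, ‖f (x + ξ) - f x‖ₑ ^ p ∂μT n ∂μT n := by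
  have h1 : Measurable fun z : (Fin n → ℝ) × (Fin n → ℝ) =>
      W (z.1 - z.2) * ‖f z.1 - f z.2‖ₑ ^ p := by fun_prop
  have h2 : Measurable fun z : (Fin n → ℝ) × (Fin n → ℝ) =>
      W z.2 * ‖f (z.2 + z.1) - f z.1‖ₑ ^ p := by fun_prop
  rw [lintegral_prod_symm _ h1.aemeasurable]
  have h3 : ∀ y : Fin n → ℝ, ∫⁻ x, W (x - y) * ‖f x - f y‖ₑ ^ p ∂μT n =
      ∫⁻ ξ, W ξ * ‖f (ξ + y) - f y‖ₑ ^ p ∂μT n := by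
    intro y
    have hper : ZPeriodic fun x => W (x - y) * ‖f x - f y‖ₑ ^ p := by
      intro x k
      simp only [hfp x k, add_sub_right_comm x, hWp (x - y) k]
    simpa using (hper.lintegral_add_right y).symm
  simp only [h3]
  rw [lintegral_lintegral_swap h2.aemeasurable]
  refine lintegral_congr fun ξ => ?_
  rw [lintegral_const_mul _ (by fun_prop)]
  simp only [add_comm]

end Torus

section Bilinear

variable {n : ℕ}

/-- The cubic energy flux `∫∫ (∑ j, κ_j(x - y) f_j(x)) f(x) · f(y)` through the kernel `κ`. -/
def flux (κ : Fin n → (Fin n → ℝ) → ℝ) (f : (Fin n → ℝ) → (Fin n → ℝ)) : ℝ :=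
  ∫ z, (∑ j, κ j (z.1 - z.2) * f z.1 j) * ∑ l, f z.1 l * f z.2 l ∂(μT n).prod (μT n)

/-- The quadratic form `∫∫ K(x - y) f(x) · f(y)`. -/
def corr (K : (Fin n → ℝ) → ℝ) (f : (Fin n → ℝ) → (Fin n → ℝ)) : ℝ :=
  ∫ z, K (z.1 - z.2) * ∑ l, f z.1 l * f z.2 l ∂(μT n).prod (μT n)

lemma abs_sum_mul_le (v w : Fin n → ℝ) : |∑ j, v j * w j| ≤ n * (‖v‖ * ‖w‖) := by
  calc |∑ j, v j * w j| ≤ ∑ j, |v j * w j| := Finset.abs_sum_le_sum_abs _ _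
    _ ≤ ∑ _j : Fin n, ‖v‖ * ‖w‖ := by
        refine Finset.sum_le_sum fun j _ => ?_
        rw [abs_mul]
        exact mul_le_mul (norm_le_pi_norm v j) (norm_le_pi_norm w j) (abs_nonneg _) (norm_nonneg _)
    _ = n * (‖v‖ * ‖w‖) := by simp

lemma integrable_norm_pow {f : (Fin n → ℝ) → (Fin n → ℝ)} (hf : Measurable f) {p : ℕ}
    (h : ∫⁻ x, ‖f x‖ₑ ^ p ∂μT n < ∞) : Integrable (fun x => ‖f x‖ ^ p) (μT n) := by
  refine ⟨by fun_prop, ?_⟩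
  simpa [HasFiniteIntegral, enorm_pow] using h

lemma integrable_prod_of_le {f : (Fin n → ℝ) → (Fin n → ℝ)} (hf : Measurable f) {p : ℕ}
    (h : ∫⁻ x, ‖f x‖ₑ ^ p ∂μT n < ∞) {g : (Fin n → ℝ) × (Fin n → ℝ) → ℝ} (hg : Measurable g)
    (C : ℝ) (hle : ∀ z, |g z| ≤ C * ((1 + ‖f z.1‖ ^ p) * (1 + ‖f z.2‖ ^ p))) :
    Integrable g ((μT n).prod (μT n)) := by
  have h1 : Integrable (fun x => 1 + ‖f x‖ ^ p) (μT n) :=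
    (integrable_const 1).add (integrable_norm_pow hf h)
  exact ((h1.mul_prod h1).const_mul C).mono' hg.aestronglyMeasurable
    (Filter.Eventually.of_forall fun z => by simpa using hle z)

lemma four_mul_flux {κ : Fin n → (Fin n → ℝ) → ℝ} (hκ : ∀ j, Continuous (κ j)) {C : ℝ}
    (hC : ∀ ξ, ‖fun j => κ j ξ‖ ≤ C) (hodd : ∀ j ξ, κ j (-ξ) = -κ j ξ)
    (hzero : ∀ j x, ∫ y, κ j (x - y) ∂μT n = 0)
    {f : (Fin n → ℝ) → (Fin n → ℝ)} (hf : Measurable f) (hf3 : ∫⁻ x, ‖f x‖ₑ ^ 3 ∂μT n < ∞)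
    (hdiv : ∀ x, ∫ y, ∑ j, κ j (x - y) * f y j ∂μT n = 0) :
    4 * flux κ f = -∫ z, (∑ j, κ j (z.1 - z.2) * (f z.1 - f z.2) j) *
      ∑ l, (f z.1 - f z.2) l * (f z.1 - f z.2) l ∂(μT n).prod (μT n) := by
  set ν := (μT n).prod (μT n)
  have hm : ∀ j, Measurable (κ j) := fun j => (hκ j).measurable
  have hC0 : 0 ≤ C := (norm_nonneg _).trans (hC 0)
  have hn : (0 : ℝ) ≤ n := n.cast_nonneg
  have hp : ∀ p : ℝ, 0 ≤ p → p ≤ 1 + p ^ 3 ∧ p ^ 2 ≤ 1 + p ^ 3 ∧ p ^ 3 ≤ 1 + p ^ 3 ∧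
      1 ≤ 1 + p ^ 3 := by
    intro p hp
    have : 0 ≤ p ^ 3 := by positivity
    refine ⟨?_, ?_, by linarith, by linarith⟩
    · nlinarith [sq_nonneg (p - 1)]
    · nlinarith [sq_nonneg (p - 1)]
  set a : (Fin n → ℝ) × (Fin n → ℝ) → ℝ := fun z => ∑ j, κ j (z.1 - z.2) * f z.1 j with ha
  set b : (Fin n → ℝ) × (Fin n → ℝ) → ℝ := fun z => ∑ j, κ j (z.1 - z.2) * f z.2 j with hb
  set s : (Fin n → ℝ) → (Fin n → ℝ) → ℝ := fun x y => ∑ l, f x l * f y l with hs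
  have hsm : Measurable fun z : (Fin n → ℝ) × (Fin n → ℝ) => s z.1 z.2 := by fun_prop
  have hsd : Measurable fun x : (Fin n → ℝ) => s x x := by fun_prop
  have ham : Measurable a := by fun_prop
  have hbm : Measurable b := by fun_prop
  have habd : ∀ z, |a z| ≤ n * C * ‖f z.1‖ := fun z =>
    (abs_sum_mul_le (fun j => κ j (z.1 - z.2)) (f z.1)).trans (by
      rw [mul_assoc]; gcongr; exact hC _)
  have hbbd : ∀ z, |b z| ≤ n * C * ‖f z.2‖ := fun z =>
    (abs_sum_mul_le (fun j => κ j (z.1 - z.2)) (f z.2)).trans (by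
      rw [mul_assoc]; gcongr; exact hC _)
  have hsbd : ∀ x y, |s x y| ≤ n * (‖f x‖ * ‖f y‖) := fun x y => abs_sum_mul_le _ _
  have i1 : Integrable (fun z => a z * s z.1 z.1) ν := by
    refine integrable_prod_of_le hf hf3 (ham.mul (hsd.comp measurable_fst)) (n * C * n) fun z => ?_
    obtain ⟨_, _, h3, _⟩ := hp _ (norm_nonneg (f z.1))
    obtain ⟨_, _, _, h4⟩ := hp _ (norm_nonneg (f z.2))
    rw [abs_mul]
    calc _ ≤ (n * C * ‖f z.1‖) * (n * (‖f z.1‖ * ‖f z.1‖)) := by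
          gcongr
          exacts [habd z, hsbd _ _]
      _ = n * C * n * (‖f z.1‖ ^ 3 * 1) := by ring
      _ ≤ _ := by gcongr
  have i2 : Integrable (fun z => b z * s z.1 z.1) ν := by
    refine integrable_prod_of_le hf hf3 (hbm.mul (hsd.comp measurable_fst)) (n * C * n) fun z => ?_
    obtain ⟨_, h3, _, _⟩ := hp _ (norm_nonneg (f z.1))
    obtain ⟨h4, _, _, _⟩ := hp _ (norm_nonneg (f z.2))
    rw [abs_mul]
    calc _ ≤ (n * C * ‖f z.2‖) * (n * (‖f z.1‖ * ‖f z.1‖)) := by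
          gcongr
          exacts [hbbd z, hsbd _ _]
      _ = n * C * n * (‖f z.1‖ ^ 2 * ‖f z.2‖) := by ring
      _ ≤ _ := by gcongr
  have i3 : Integrable (fun z => a z * s z.1 z.2) ν := by
    refine integrable_prod_of_le hf hf3 (ham.mul hsm) (n * C * n) fun z => ?_
    obtain ⟨_, h3, _, _⟩ := hp _ (norm_nonneg (f z.1))
    obtain ⟨h4, _, _, _⟩ := hp _ (norm_nonneg (f z.2))
    rw [abs_mul]
    calc _ ≤ (n * C * ‖f z.1‖) * (n * (‖f z.1‖ * ‖f z.2‖)) := by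
          gcongr
          exacts [habd z, hsbd _ _]
      _ = n * C * n * (‖f z.1‖ ^ 2 * ‖f z.2‖) := by ring
      _ ≤ _ := by gcongr
  have hab : ∀ z, a z.swap = -b z := by
    intro z
    simp only [ha, hb, Prod.fst_swap, Prod.snd_swap, ← Finset.sum_neg_distrib, ← neg_mul, ← hodd,
      neg_sub]
  have hba : ∀ z, b z.swap = -a z := by
    intro z
    simp only [ha, hb, Prod.fst_swap, Prod.snd_swap, ← Finset.sum_neg_distrib, ← neg_mul, ← hodd,
      neg_sub]
  have hss : ∀ x y, s x y = s y x := fun x y => by simp only [hs, mul_comm]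
  have z1 : ∫ z, a z * s z.1 z.1 ∂ν = 0 := by
    rw [integral_prod _ i1]
    refine integral_eq_zero_of_ae (Filter.Eventually.of_forall fun x => ?_)
    simp only [ha, Pi.zero_apply]
    rw [integral_mul_const, integral_finsetSum]
    · simp [integral_mul_const, hzero]
    · intro j _
      refine Integrable.mul_const (Integrable.of_bound (C := C) (by fun_prop) ?_) _
      exact Filter.Eventually.of_forall fun y =>
        (norm_le_pi_norm (fun j => κ j (x - y)) j).trans (hC _)
  have z2 : ∫ z, b z * s z.1 z.1 ∂ν = 0 := by
    rw [integral_prod _ i2]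
    refine integral_eq_zero_of_ae (Filter.Eventually.of_forall fun x => ?_)
    simp only [hb, Pi.zero_apply]
    rw [integral_mul_const, hdiv, zero_mul]
  have hsw : ∀ g : (Fin n → ℝ) × (Fin n → ℝ) → ℝ, ∫ z, g z.swap ∂ν = ∫ z, g z ∂ν :=
    fun g => integral_prod_swap g
  have swI : ∀ {g : (Fin n → ℝ) × (Fin n → ℝ) → ℝ}, Integrable g ν →
      Integrable (fun z => g z.swap) ν := fun h => h.swap
  set G : (Fin n → ℝ) × (Fin n → ℝ) → ℝ :=
    fun z => a z * s z.1 z.1 - b z * s z.1 z.1 - 2 * (a z * s z.1 z.2) with hG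
  have key : ∀ z : (Fin n → ℝ) × (Fin n → ℝ), (∑ j, κ j (z.1 - z.2) * (f z.1 - f z.2) j) *
      ∑ l, (f z.1 - f z.2) l * (f z.1 - f z.2) l =
      G z +
      G z.swap := by
    intro z
    simp only [hG, hab, hba, Prod.fst_swap, Prod.snd_swap]
    have e1 : ∑ j, κ j (z.1 - z.2) * (f z.1 - f z.2) j = a z - b z := by
      simp only [ha, hb, ← Finset.sum_sub_distrib, Pi.sub_apply, mul_sub]
    have e2 : ∑ l, (f z.1 - f z.2) l * (f z.1 - f z.2) l =
        s z.1 z.1 + s z.2 z.2 - 2 * s z.1 z.2 := by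
      simp only [hs, ← Finset.sum_sub_distrib, ← Finset.sum_add_distrib, Finset.mul_sum,
        Pi.sub_apply]
      exact Finset.sum_congr rfl fun l _ => by ring
    rw [e1, e2, hss z.2 z.1]
    ring
  have iG : Integrable G ν := ((i1.sub i2).sub (i3.const_mul 2))
  have eG : ∫ z, G z ∂ν = ∫ z, a z * s z.1 z.1 ∂ν - ∫ z, b z * s z.1 z.1 ∂ν -
      ∫ z, 2 * (a z * s z.1 z.2) ∂ν := by
    refine (integral_sub (i1.sub i2) (i3.const_mul 2)).trans ?_
    congr 1
    exact integral_sub i1 i2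
  simp only [key]
  rw [integral_add iG (swI iG), hsw, eG, z1, z2, integral_const_mul]
  simp only [flux]
  ring

lemma enorm_flux_le {κ : Fin n → (Fin n → ℝ) → ℝ} (hκ : ∀ j, Continuous (κ j)) {C : ℝ}
    (hC : ∀ ξ, ‖fun j => κ j ξ‖ ≤ C) (hodd : ∀ j ξ, κ j (-ξ) = -κ j ξ)
    (hper : ∀ j, ZPeriodic (κ j)) (hzero : ∀ j x, ∫ y, κ j (x - y) ∂μT n = 0)
    {f : (Fin n → ℝ) → (Fin n → ℝ)} (hf : Measurable f) (hfp : ZPeriodic f)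
    (hf3 : ∫⁻ x, ‖f x‖ₑ ^ 3 ∂μT n < ∞)
    (hdiv : ∀ x, ∫ y, ∑ j, κ j (x - y) * f y j ∂μT n = 0) :
    ‖flux κ f‖ₑ ≤ n * ∑ j, ∫⁻ ξ, ‖κ j ξ‖ₑ * ∫⁻ x, ‖f (x + ξ) - f x‖ₑ ^ 3 ∂μT n ∂μT n := by
  have h4 := four_mul_flux hκ hC hodd hzero hf hf3 hdiv
  have hm : ∀ j, Measurable (κ j) := fun j => (hκ j).measurable
  have h5 : ‖flux κ f‖ₑ ≤ ‖4 * flux κ f‖ₑ := by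
    refine enorm_le_iff_norm_le.2 ?_
    rw [norm_mul, Real.norm_ofNat]
    linarith [norm_nonneg (flux κ f)]
  refine h5.trans ?_
  rw [h4, enorm_neg]
  refine (enorm_integral_le_lintegral_enorm _).trans ?_
  have h6 : ∀ j, ∫⁻ ξ, ‖κ j ξ‖ₑ * ∫⁻ x, ‖f (x + ξ) - f x‖ₑ ^ 3 ∂μT n ∂μT n =
      ∫⁻ z, ‖κ j (z.1 - z.2)‖ₑ * ‖f z.1 - f z.2‖ₑ ^ 3 ∂(μT n).prod (μT n) := fun j =>
    (lintegral_lintegral_sub_eq (W := fun ξ => ‖κ j ξ‖ₑ) (by fun_prop)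
      (fun x k => by simp only [hper j x k]) hf hfp 3).symm
  simp only [h6]
  rw [← lintegral_finsetSum _ (fun j _ => by fun_prop), ← lintegral_const_mul _ (by fun_prop)]
  refine lintegral_mono fun z => ?_
  set d := f z.1 - f z.2
  have h7 : ∀ j, ‖d j‖ₑ ≤ ‖d‖ₑ := fun j => enorm_le_iff_norm_le.2 (norm_le_pi_norm d j)
  have h8 : ‖∑ j, κ j (z.1 - z.2) * d j‖ₑ ≤ ∑ j, ‖κ j (z.1 - z.2)‖ₑ * ‖d‖ₑ := by
    refine (enorm_sum_le _ _).trans (Finset.sum_le_sum fun j _ => ?_)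
    rw [enorm_mul]
    gcongr
    exact h7 j
  have h9 : ‖∑ l, d l * d l‖ₑ ≤ n * ‖d‖ₑ ^ 2 := by
    refine (enorm_sum_le _ _).trans
      ((Finset.sum_le_sum (g := fun _ => ‖d‖ₑ ^ 2) fun j _ => ?_).trans
      (by simp))
    rw [enorm_mul, sq]
    gcongr <;> exact h7 j
  calc _ ≤ (∑ j, ‖κ j (z.1 - z.2)‖ₑ * ‖d‖ₑ) * (n * ‖d‖ₑ ^ 2) := by
        rw [enorm_mul]; gcongr
    _ = _ := by
        rw [← Finset.sum_mul, ← Finset.sum_mul]; ring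

lemma sq_integral_sub_corr {K : (Fin n → ℝ) → ℝ} (hK : Continuous K) {C : ℝ}
    (hC : ∀ ξ, |K ξ| ≤ C) (heven : ∀ ξ, K (-ξ) = K ξ)
    (hone : ∀ x, ∫ y, K (x - y) ∂μT n = 1)
    {f : (Fin n → ℝ) → (Fin n → ℝ)} (hf : Measurable f) (hf2 : ∫⁻ x, ‖f x‖ₑ ^ 2 ∂μT n < ∞) :
    2 * (∫ x, ∑ l, f x l ^ 2 ∂μT n - corr K f) = ∫ z, K (z.1 - z.2) *
      ∑ l, (f z.1 - f z.2) l * (f z.1 - f z.2) l ∂(μT n).prod (μT n) := by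
  set ν := (μT n).prod (μT n)
  have hm : Measurable K := hK.measurable
  have hC0 : 0 ≤ C := (abs_nonneg _).trans (hC 0)
  have hn : (0 : ℝ) ≤ n := n.cast_nonneg
  set s : (Fin n → ℝ) → (Fin n → ℝ) → ℝ := fun x y => ∑ l, f x l * f y l with hs
  have hsm : Measurable fun z : (Fin n → ℝ) × (Fin n → ℝ) => s z.1 z.2 := by fun_prop
  have hsd : Measurable fun x : (Fin n → ℝ) => s x x := by fun_prop
  have hsbd : ∀ x y, |s x y| ≤ n * (‖f x‖ * ‖f y‖) := fun x y => abs_sum_mul_le _ _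
  have i1 : Integrable (fun z => K (z.1 - z.2) * s z.1 z.1) ν := by
    refine integrable_prod_of_le hf hf2 (.mul (by fun_prop) (hsd.comp measurable_fst)) (C * n)
      fun z => ?_
    rw [abs_mul]
    calc _ ≤ C * (n * (‖f z.1‖ * ‖f z.1‖)) := by
          gcongr
          exacts [hC _, hsbd _ _]
      _ = C * n * (‖f z.1‖ ^ 2 * 1) := by ring
      _ ≤ _ := by
        gcongr
        · linarith
        · linarith [sq_nonneg ‖f z.2‖]
  have i3 : Integrable (fun z => K (z.1 - z.2) * s z.1 z.2) ν := by
    refine integrable_prod_of_le hf hf2 (.mul (by fun_prop) hsm) (C * n) fun z => ?_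
    rw [abs_mul]
    calc _ ≤ C * (n * (‖f z.1‖ * ‖f z.2‖)) := by
          gcongr
          exacts [hC _, hsbd _ _]
      _ = C * n * (‖f z.1‖ * ‖f z.2‖) := by ring
      _ ≤ _ := by
        gcongr
        · nlinarith [sq_nonneg (‖f z.1‖ - 1)]
        · nlinarith [sq_nonneg (‖f z.2‖ - 1)]
  have hss : ∀ x y, s x y = s y x := fun x y => by simp only [hs, mul_comm]
  have z1 : ∫ z, K (z.1 - z.2) * s z.1 z.1 ∂ν = ∫ x, ∑ l, f x l ^ 2 ∂μT n := by
    rw [integral_prod _ i1]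
    simp only [integral_mul_const, hone, one_mul, hs, sq]
  have hsw : ∀ g : (Fin n → ℝ) × (Fin n → ℝ) → ℝ, ∫ z, g z.swap ∂ν = ∫ z, g z ∂ν :=
    fun g => integral_prod_swap g
  have swI : ∀ {g : (Fin n → ℝ) × (Fin n → ℝ) → ℝ}, Integrable g ν →
      Integrable (fun z => g z.swap) ν := fun h => h.swap
  set G : (Fin n → ℝ) × (Fin n → ℝ) → ℝ :=
    fun z => K (z.1 - z.2) * s z.1 z.1 - K (z.1 - z.2) * s z.1 z.2 with hG
  have key : ∀ z : (Fin n → ℝ) × (Fin n → ℝ), K (z.1 - z.2) *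
      ∑ l, (f z.1 - f z.2) l * (f z.1 - f z.2) l =
      G z +
      G z.swap := by
    intro z
    simp only [hG, Prod.fst_swap, Prod.snd_swap]
    have e2 : ∑ l, (f z.1 - f z.2) l * (f z.1 - f z.2) l =
        s z.1 z.1 + s z.2 z.2 - 2 * s z.1 z.2 := by
      simp only [hs, ← Finset.sum_sub_distrib, ← Finset.sum_add_distrib, Finset.mul_sum,
        Pi.sub_apply]
      exact Finset.sum_congr rfl fun l _ => by ring
    rw [e2, hss z.2 z.1, ← heven (z.2 - z.1), neg_sub]
    ring
  have iG : Integrable G ν := i1.sub i3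
  have eG : ∫ z, G z ∂ν = ∫ z, K (z.1 - z.2) * s z.1 z.1 ∂ν -
      ∫ z, K (z.1 - z.2) * s z.1 z.2 ∂ν := integral_sub i1 i3
  simp only [key]
  rw [integral_add iG (swI iG), hsw, eG, z1]
  simp only [corr]
  ring

lemma enorm_sq_integral_sub_corr_le {K : (Fin n → ℝ) → ℝ} (hK : Continuous K) {C : ℝ}
    (hC : ∀ ξ, |K ξ| ≤ C) (heven : ∀ ξ, K (-ξ) = K ξ) (hper : ZPeriodic K)
    (hone : ∀ x, ∫ y, K (x - y) ∂μT n = 1)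
    {f : (Fin n → ℝ) → (Fin n → ℝ)} (hf : Measurable f) (hfp : ZPeriodic f)
    (hf2 : ∫⁻ x, ‖f x‖ₑ ^ 2 ∂μT n < ∞) :
    ‖∫ x, ∑ l, f x l ^ 2 ∂μT n - corr K f‖ₑ ≤
      n * ∫⁻ ξ, ‖K ξ‖ₑ * ∫⁻ x, ‖f (x + ξ) - f x‖ₑ ^ 2 ∂μT n ∂μT n := by
  have hm : Measurable K := hK.measurable
  have h4 := sq_integral_sub_corr hK hC heven hone hf hf2
  set A := ∫ x, ∑ l, f x l ^ 2 ∂μT n - corr K f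
  have h5 : ‖A‖ₑ ≤ ‖2 * A‖ₑ := by
    refine enorm_le_iff_norm_le.2 ?_
    rw [norm_mul, Real.norm_ofNat]
    linarith [norm_nonneg A]
  refine h5.trans ?_
  rw [h4]
  refine (enorm_integral_le_lintegral_enorm _).trans ?_
  rw [← lintegral_lintegral_sub_eq (W := fun ξ => ‖K ξ‖ₑ) (by fun_prop)
      (fun x k => by simp only [hper x k]) hf hfp 2, ← lintegral_const_mul _ (by fun_prop)]
  refine lintegral_mono fun z => ?_
  set d := f z.1 - f z.2
  have h7 : ∀ j, ‖d j‖ₑ ≤ ‖d‖ₑ := fun j => enorm_le_iff_norm_le.2 (norm_le_pi_norm d j)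
  have h9 : ‖∑ l, d l * d l‖ₑ ≤ n * ‖d‖ₑ ^ 2 := by
    refine (enorm_sum_le _ _).trans
      ((Finset.sum_le_sum (g := fun _ => ‖d‖ₑ ^ 2) fun j _ => ?_).trans
      (by simp))
    rw [enorm_mul, sq]
    gcongr <;> exact h7 j
  calc _ ≤ ‖K (z.1 - z.2)‖ₑ * (n * ‖d‖ₑ ^ 2) := by
        rw [enorm_mul]; gcongr
    _ = _ := by ring

end Bilinear

section Time

variable {T : ℝ}

lemma setIntegral_Ioo_eq (hT : 0 < T) (f : ℝ → ℝ) :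
    ∫ t in Set.Ioo 0 T, f t = ∫ t in (0 : ℝ)..T, f t := by
  rw [intervalIntegral.integral_of_le hT.le, integral_Ioc_eq_integral_Ioo]

lemma intervalIntegrable_of_Ioo (hT : 0 < T) {f : ℝ → ℝ} (hf : IntegrableOn f (Set.Ioo 0 T)) :
    IntervalIntegrable f volume 0 T := by
  rwa [intervalIntegrable_iff_integrableOn_Ioo_of_le hT.le]

lemma integral_deriv_mul_primitive (hT : 0 < T) {g : ℝ → ℝ} (hg : IntegrableOn g (Set.Ioo 0 T))
    {A : ℝ → ℝ} (hA : AbsolutelyContinuousOnInterval A 0 T) :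
    ∫ t in (0 : ℝ)..T, (deriv A t * (∫ r in (0 : ℝ)..t, g r) + A t * g t) =
      A T * ∫ r in (0 : ℝ)..T, g r := by
  have hgi := intervalIntegrable_of_Ioo hT hg
  have hG := hgi.absolutelyContinuousOnInterval_intervalIntegral (c := 0) (by simp)
  have h := hA.integral_deriv_mul_eq_sub hG
  simp only [intervalIntegral.integral_same, mul_zero, sub_zero] at h
  rw [← h]
  apply intervalIntegral.integral_congr_ae
  filter_upwards [hgi.ae_hasDerivAt_integral] with t ht htm
  rw [(ht (Set.uIoc_subset_uIcc htm) 0 (by simp)).deriv]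

lemma sq_primitive (hT : 0 < T) {g : ℝ → ℝ} (hg : IntegrableOn g (Set.Ioo 0 T)) (c : ℝ) :
    (c + ∫ r in (0 : ℝ)..T, g r) ^ 2 =
      c ^ 2 + 2 * ∫ t in (0 : ℝ)..T, (c + ∫ r in (0 : ℝ)..t, g r) * g t := by
  have hgi := intervalIntegrable_of_Ioo hT hg
  have hG := hgi.absolutelyContinuousOnInterval_intervalIntegral (c := 0) (by simp)
  have h := integral_deriv_mul_primitive hT hg hG
  have h2 : ∫ t in (0 : ℝ)..T, (deriv (fun t => ∫ r in (0 : ℝ)..t, g r) t *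
      (∫ r in (0 : ℝ)..t, g r) + (∫ r in (0 : ℝ)..t, g r) * g t) =
      ∫ t in (0 : ℝ)..T, 2 * ((∫ r in (0 : ℝ)..t, g r) * g t) := by
    apply intervalIntegral.integral_congr_ae
    filter_upwards [hgi.ae_hasDerivAt_integral] with t ht htm
    rw [(ht (Set.uIoc_subset_uIcc htm) 0 (by simp)).deriv]
    ring
  rw [h2, intervalIntegral.integral_const_mul] at h
  have h3 : ∫ t in (0 : ℝ)..T, (c + ∫ r in (0 : ℝ)..t, g r) * g t =
      c * (∫ r in (0 : ℝ)..T, g r) + ∫ t in (0 : ℝ)..T, (∫ r in (0 : ℝ)..t, g r) * g t := by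
    simp only [add_mul]
    rw [intervalIntegral.integral_add (hgi.const_mul c) (hgi.continuousOn_mul hG.continuousOn),
      intervalIntegral.integral_const_mul]
  rw [h3, mul_add, h]
  ring

lemma ae_eq_primitive_of_weak (hT : 0 < T) {f g : ℝ → ℝ} (hf : IntegrableOn f (Set.Ioo 0 T))
    (hg : IntegrableOn g (Set.Ioo 0 T)) (c : ℝ)
    (H : ∀ θ : ℝ → ℝ, ContDiff ℝ (⊤ : ℕ∞) θ → (∃ T', T' < T ∧ ∀ t ≥ T', θ t = 0) →
      (∫ t in Set.Ioo 0 T, (deriv θ t * f t + θ t * g t)) + θ 0 * c = 0) :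
    ∀ᵐ t ∂volume.restrict (Set.Ioo 0 T), f t = c + ∫ r in (0 : ℝ)..t, g r := by
  have hgi := intervalIntegrable_of_Ioo hT hg
  have hfi := intervalIntegrable_of_Ioo hT hf
  have hG := hgi.absolutelyContinuousOnInterval_intervalIntegral (c := 0) (by simp)
  set h : ℝ → ℝ := fun t => f t - (c + ∫ r in (0 : ℝ)..t, g r) with hh
  have hGi : IntervalIntegrable (fun t => c + ∫ r in (0 : ℝ)..t, g r) volume 0 T :=
    (continuousOn_const.add hG.continuousOn).intervalIntegrable
  have hhi : IntegrableOn h (Set.Ioo 0 T) := by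
    rw [← intervalIntegrable_iff_integrableOn_Ioo_of_le hT.le]
    exact hfi.sub hGi
  have key := isOpen_Ioo.ae_eq_zero_of_integral_contDiff_smul_eq_zero (μ := volume)
    (f := h) (U := Set.Ioo 0 T) hhi.locallyIntegrableOn ?_
  · rw [ae_restrict_iff' measurableSet_Ioo]
    filter_upwards [key] with t ht htm
    have := ht htm
    simp only [hh] at this
    linarith
  intro ψ hψ hc hsupp
  have hψ0 : ∀ x ∉ Set.Ioo 0 T, ψ x = 0 := fun x hx =>
    image_eq_zero_of_notMem_tsupport fun h => hx (hsupp h)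
  obtain ⟨T', hT', hz⟩ : ∃ T' < T, ∀ t, T' < t → ψ t = 0 := by
    rcases (tsupport ψ).eq_empty_or_nonempty with he | hne
    · exact ⟨T - 1, by linarith, fun t _ => image_eq_zero_of_notMem_tsupport (by simp [he])⟩
    · obtain ⟨m, hm, hmax⟩ := hc.isCompact.exists_isGreatest hne
      exact ⟨m, (hsupp hm).2, fun t ht => image_eq_zero_of_notMem_tsupport
        fun h => absurd (hmax h) (not_le.2 ht)⟩
  set θ : ℝ → ℝ := fun t => ∫ r in T..t, ψ r with hθ
  have hd : ∀ t, HasDerivAt θ (ψ t) t := fun t =>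
    intervalIntegral.integral_hasDerivAt_right (hψ.continuous.intervalIntegrable _ _)
      (hψ.continuous.stronglyMeasurableAtFilter _ _) hψ.continuous.continuousAt
  have hdθ : deriv θ = ψ := funext fun t => (hd t).deriv
  have hθs : ContDiff ℝ (⊤ : ℕ∞) θ := by
    rw [contDiff_infty_iff_deriv, hdθ]
    exact ⟨fun t => (hd t).differentiableAt, hψ⟩
  have hθT : θ T = 0 := by simp [hθ]
  have hθ0 : θ 0 = -∫ r in (0 : ℝ)..T, ψ r := by
    simp only [hθ]
    rw [intervalIntegral.integral_symm]
  have hv : ∀ t ≥ T', θ t = 0 := by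
    intro t ht
    refine intervalIntegral.integral_zero_ae (Filter.Eventually.of_forall fun r hr => hz r ?_)
    exact lt_of_le_of_lt (le_min hT'.le ht) hr.1
  have h1 := H θ hθs ⟨T', hT', hv⟩
  have hAC : AbsolutelyContinuousOnInterval θ 0 T :=
    ContDiffOn.absolutelyContinuousOnInterval ((hθs.of_le (by simp)).contDiffOn)
  have h2 := integral_deriv_mul_primitive hT hg hAC
  have iψf : IntervalIntegrable (fun t => ψ t * f t) volume 0 T :=
    hfi.continuousOn_mul hψ.continuous.continuousOn
  have iθg : IntervalIntegrable (fun t => θ t * g t) volume 0 T :=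
    hgi.continuousOn_mul hθs.continuous.continuousOn
  have iψG : IntervalIntegrable (fun t => ψ t * ∫ r in (0 : ℝ)..t, g r) volume 0 T :=
    (hψ.continuous.continuousOn.mul hG.continuousOn).intervalIntegrable
  have iψc : IntervalIntegrable (fun t => ψ t * c) volume 0 T :=
    (hψ.continuous.mul continuous_const).intervalIntegrable _ _
  rw [hdθ, hθT, zero_mul, intervalIntegral.integral_add iψG iθg] at h2
  rw [setIntegral_Ioo_eq hT, hdθ, intervalIntegral.integral_add iψf iθg, hθ0] at h1
  rw [← setIntegral_eq_integral_of_forall_compl_eq_zero (s := Set.Ioo 0 T)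
    (fun x hx => by rw [hψ0 x hx, zero_smul]), setIntegral_Ioo_eq hT]
  have h3 : ∀ t, ψ t • h t = ψ t * f t - (ψ t * c + ψ t * ∫ r in (0 : ℝ)..t, g r) := by
    intro t
    simp only [hh, smul_eq_mul]
    ring
  simp only [h3]
  rw [intervalIntegral.integral_sub iψf (iψc.add iψG), intervalIntegral.integral_add iψc iψG,
    intervalIntegral.integral_mul_const]
  linarith

end Time

section Mode

variable {n : ℕ}

lemma ZPeriodic.exists_bound {E : Type*} [NormedAddCommGroup E] {K : (Fin n → ℝ) → E}
    (hp : ZPeriodic K) (hK : Continuous K) : ∃ C, ∀ ξ, ‖K ξ‖ ≤ C := by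
  obtain ⟨C, hC⟩ := (isCompact_Icc (a := (0 : Fin n → ℝ)) (b := 1)).exists_bound_of_continuousOn
    hK.continuousOn
  refine ⟨C, fun ξ => ?_⟩
  have h := hp (fun i => Int.fract (ξ i)) (fun i => ⌊ξ i⌋)
  have e : ((fun i => Int.fract (ξ i)) + fun i => ((⌊ξ i⌋ : ℤ) : ℝ)) = ξ := by
    ext i
    simp
  rw [e] at h
  rw [h]
  exact hC _ ⟨fun i => Int.fract_nonneg _, fun i => (Int.fract_lt_one _).le⟩

/-- The trigonometric mode `cos (2π k · x + s)`. -/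
def mode (k : Fin n → ℤ) (s : ℝ) (x : Fin n → ℝ) : ℝ :=
  Real.cos (2 * Real.pi * ∑ i, k i * x i + s)

lemma contDiff_mode (k : Fin n → ℤ) (s : ℝ) : ContDiff ℝ (⊤ : ℕ∞) (mode k s) := by
  unfold mode
  refine Real.contDiff_cos.comp ?_
  fun_prop

lemma continuous_mode (k : Fin n → ℤ) (s : ℝ) : Continuous (mode k s) :=
  (contDiff_mode k s).continuous

lemma zperiodic_mode (k : Fin n → ℤ) (s : ℝ) : ZPeriodic (mode k s) := by
  intro x m
  have : 2 * Real.pi * ∑ i, (k i : ℝ) * (x + fun i => (m i : ℝ)) i + s =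
      2 * Real.pi * ∑ i, (k i : ℝ) * x i + s + (∑ i, k i * m i : ℤ) * (2 * Real.pi) := by
    push_cast
    simp only [Pi.add_apply, mul_add, Finset.sum_add_distrib]
    ring
  rw [mode, this, Real.cos_add_int_mul_two_pi, mode]

lemma pd_mode (k : Fin n → ℤ) (s : ℝ) (j : Fin n) (x : Fin n → ℝ) :
    pd j (mode k s) x = 2 * Real.pi * k j * mode k (s + Real.pi / 2) x := by
  have hs : HasFDerivAt (fun x : Fin n → ℝ => 2 * Real.pi * ∑ i, (k i : ℝ) * x i + s)
      ((2 * Real.pi) • ∑ i,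
        (k i : ℝ) • ContinuousLinearMap.proj (R := ℝ) (φ := fun _ => ℝ) i) x := by
    refine HasFDerivAt.add_const s (HasFDerivAt.const_mul (HasFDerivAt.fun_sum fun i _ => ?_) _)
    exact (hasFDerivAt_apply (𝕜 := ℝ) (F' := fun _ : Fin n => ℝ) i x).const_mul (k i : ℝ)
  have h2 : fderiv ℝ (mode k s) x = _ := hs.cos.fderiv
  rw [pd, h2, mode, ← add_assoc, Real.cos_add_pi_div_two]
  simp only [_root_.smul_apply, _root_.sum_apply,
    ContinuousLinearMap.proj_apply, Pi.single_apply, smul_eq_mul, mul_ite, mul_one, mul_zero,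
    Finset.sum_ite_eq', Finset.mem_univ, if_true]
  ring

lemma mode_zero_neg (k : Fin n → ℤ) (x : Fin n → ℝ) : mode k 0 (-x) = mode k 0 x := by
  simp [mode]

lemma mode_sub (k : Fin n → ℤ) (x y : Fin n → ℝ) (s : ℝ) :
    mode k s (x - y) = mode k s x * mode k 0 y +
      mode k (s - Real.pi / 2) x * mode k (-(Real.pi / 2)) y := by
  have : 2 * Real.pi * ∑ i, (k i : ℝ) * (x - y) i + s =
      (2 * Real.pi * ∑ i, (k i : ℝ) * x i + s) - (2 * Real.pi * ∑ i, (k i : ℝ) * y i) := by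
    simp only [Pi.sub_apply, mul_sub, Finset.sum_sub_distrib]
    ring
  rw [mode, this, Real.cos_sub]
  simp only [mode, add_zero, ← sub_eq_add_neg, ← add_sub_assoc, Real.cos_sub_pi_div_two]

lemma mode_mul_mode (k l : Fin n → ℤ) :
    mode k 0 * mode l 0 = (1 / 2 : ℝ) • mode (k + l) 0 + (1 / 2 : ℝ) • mode (k - l) 0 := by
  ext x
  have e1 : 2 * Real.pi * ∑ i, ((k + l) i : ℝ) * x i =
    2 * Real.pi * ∑ i, (k i : ℝ) * x i + 2 * Real.pi * ∑ i, (l i : ℝ) * x i := by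
    simp [add_mul, Finset.sum_add_distrib, mul_add]
  have e2 : 2 * Real.pi * ∑ i, ((k - l) i : ℝ) * x i =
    2 * Real.pi * ∑ i, (k i : ℝ) * x i - 2 * Real.pi * ∑ i, (l i : ℝ) * x i := by
    simp [sub_mul, Finset.sum_sub_distrib, mul_sub]
  change Real.cos (2 * Real.pi * ∑ i, (k i : ℝ) * x i + 0) *
      Real.cos (2 * Real.pi * ∑ i, (l i : ℝ) * x i + 0) =
    1 / 2 * Real.cos (2 * Real.pi * ∑ i, ((k + l) i : ℝ) * x i + 0) +
      1 / 2 * Real.cos (2 * Real.pi * ∑ i, ((k - l) i : ℝ) * x i + 0)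
  rw [e1, e2, add_zero, add_zero, add_zero, add_zero, Real.cos_add, Real.cos_sub]
  ring

lemma pd_add {f g : (Fin n → ℝ) → ℝ} (hf : ContDiff ℝ (⊤ : ℕ∞) f) (hg : ContDiff ℝ (⊤ : ℕ∞) g)
    (j : Fin n) (x : Fin n → ℝ) : pd j (f + g) x = pd j f x + pd j g x := by
  rw [pd, fderiv_add (hf.differentiable (by simp) x) (hg.differentiable (by simp) x)]
  rfl

lemma pd_smul {f : (Fin n → ℝ) → ℝ} (hf : ContDiff ℝ (⊤ : ℕ∞) f) (c : ℝ)
    (j : Fin n) (x : Fin n → ℝ) : pd j (c • f) x = c * pd j f x := by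
  rw [pd, fderiv_const_smul (hf.differentiable (by simp) x)]
  rfl

lemma continuous_pd {f : (Fin n → ℝ) → ℝ} (hf : ContDiff ℝ (⊤ : ℕ∞) f) (j : Fin n) :
    Continuous (pd j f) := by
  have := hf.continuous_fderiv (by simp)
  unfold pd
  fun_prop

lemma ZPeriodic.pd {f : (Fin n → ℝ) → ℝ} (hf : ZPeriodic f) (j : Fin n) : ZPeriodic (pd j f) := by
  intro x k
  rw [_root_.pd, _root_.pd, ← fderiv_comp_add_right]
  simp only [hf _ k]

lemma pd_comp_sub {f : (Fin n → ℝ) → ℝ} (hf : ContDiff ℝ (⊤ : ℕ∞) f) (x : Fin n → ℝ) (j : Fin n)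
    (y : Fin n → ℝ) : pd j (fun y => f (x - y)) y = -pd j f (x - y) := by
  have h : HasFDerivAt f (fderiv ℝ f (x - y)) (x - y) :=
    (hf.differentiable (by simp) _).hasFDerivAt
  have h2 := h.comp y ((hasFDerivAt_id y).const_sub x)
  change fderiv ℝ (f ∘ fun y => x - y) y _ = _
  erw [h2.fderiv]
  simp [pd]

lemma pd_neg {f : (Fin n → ℝ) → ℝ} (hf : ContDiff ℝ (⊤ : ℕ∞) f) (he : ∀ x, f (-x) = f x)
    (j : Fin n) (x : Fin n → ℝ) : pd j f (-x) = -pd j f x := by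
  have h := pd_comp_sub hf 0 j x
  simp only [zero_sub, he] at h
  rw [show (fun y => f y) = f from rfl] at h
  linarith

lemma integral_mode_eq_zero {k : Fin n → ℤ} (hk : k ≠ 0) (s : ℝ) : ∫ x, mode k s x ∂μT n = 0 := by
  obtain ⟨j, hj⟩ : ∃ j, k j ≠ 0 := by
    by_contra! h
    exact hk (funext h)
  have hj' : (k j : ℝ) ≠ 0 := by exact_mod_cast hj
  have h := (zperiodic_mode k s).integral_add_right
    (Pi.single j (1 / (2 * k j)))
  have e : ∀ x, mode k s (x + Pi.single j (1 / (2 * (k j : ℝ)))) = -mode k s x := by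
    intro x
    have : 2 * Real.pi * ∑ i, (k i : ℝ) * (x + Pi.single j (1 / (2 * (k j : ℝ))) : Fin n → ℝ) i +
        s =
        (2 * Real.pi * ∑ i, (k i : ℝ) * x i + s) + Real.pi := by
      simp only [Pi.add_apply, mul_add, Finset.sum_add_distrib, Pi.single_apply, mul_ite, mul_zero,
        Finset.sum_ite_eq', Finset.mem_univ, if_true]
      field_simp
      ring
    rw [mode, this, Real.cos_add_pi, mode]
  simp only [e, integral_neg] at h
  linarith

end Mode

section Coeff

variable {n : ℕ}

/-- The pairing `∫ f_i φ` of the `i`-th component of `f` with `φ`. -/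
def pairing (φ : (Fin n → ℝ) → ℝ) (i : Fin n) (f : (Fin n → ℝ) → (Fin n → ℝ)) : ℝ :=
  ∫ x, f x i * φ x ∂μT n

/-- The pairing `∫ f_i f · ∇φ` of the convective term with `φ`. -/
def convPairing (φ : (Fin n → ℝ) → ℝ) (i : Fin n) (f : (Fin n → ℝ) → (Fin n → ℝ)) : ℝ :=
  ∫ x, ∑ j, f x i * f x j * pd j φ x ∂μT n

variable {f : (Fin n → ℝ) → (Fin n → ℝ)}

lemma abs_apply_mul_le {ψ : ℝ} {B : ℝ} (hB : |ψ| ≤ B) (v : Fin n → ℝ) (i : Fin n) :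
    |v i * ψ| ≤ B * (1 + ‖v‖ ^ 2) := by
  have h0 : 0 ≤ B := (abs_nonneg _).trans hB
  have h1 : |v i| ≤ 1 + ‖v‖ ^ 2 := by
    have := norm_le_pi_norm v i
    rw [Real.norm_eq_abs] at this
    nlinarith [sq_nonneg (‖v‖ - 1)]
  rw [abs_mul, mul_comm]
  gcongr

lemma abs_apply_mul_apply_mul_le {ψ : ℝ} {B : ℝ} (hB : |ψ| ≤ B) (v : Fin n → ℝ) (i j : Fin n) :
    |v i * v j * ψ| ≤ B * (1 + ‖v‖ ^ 2) := by
  have h0 : 0 ≤ B := (abs_nonneg _).trans hB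
  have h1 : |v i| * |v j| ≤ 1 + ‖v‖ ^ 2 := by
    have h1 := norm_le_pi_norm v i
    have h2 := norm_le_pi_norm v j
    rw [Real.norm_eq_abs] at h1 h2
    nlinarith [mul_le_mul h1 h2 (abs_nonneg _) (norm_nonneg _)]
  rw [abs_mul, abs_mul, mul_comm]
  gcongr

lemma integrable_one_add_sq (hf : Measurable f) (hf2 : ∫⁻ x, ‖f x‖ₑ ^ 2 ∂μT n < ∞) :
    Integrable (fun x => 1 + ‖f x‖ ^ 2) (μT n) :=
  (integrable_const 1).add (integrable_norm_pow hf hf2)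

lemma integrable_apply_mul (hf : Measurable f) (hf2 : ∫⁻ x, ‖f x‖ₑ ^ 2 ∂μT n < ∞)
    {φ : (Fin n → ℝ) → ℝ} (hφ : Continuous φ) (hp : ZPeriodic φ) (i : Fin n) :
    Integrable (fun x => f x i * φ x) (μT n) := by
  obtain ⟨B, hB⟩ := hp.exists_bound hφ
  exact ((integrable_one_add_sq hf hf2).const_mul B).mono' (by fun_prop)
    (Filter.Eventually.of_forall fun x => abs_apply_mul_le (hB x) _ _)

lemma integrable_apply_mul_apply_mul (hf : Measurable f) (hf2 : ∫⁻ x, ‖f x‖ₑ ^ 2 ∂μT n < ∞)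
    {φ : (Fin n → ℝ) → ℝ} (hφ : Continuous φ) (hp : ZPeriodic φ) (i j : Fin n) :
    Integrable (fun x => f x i * f x j * φ x) (μT n) := by
  obtain ⟨B, hB⟩ := hp.exists_bound hφ
  exact ((integrable_one_add_sq hf hf2).const_mul B).mono' (by fun_prop)
    (Filter.Eventually.of_forall fun x => abs_apply_mul_apply_mul_le (hB x) _ _ _)

lemma integrable_conv (hf : Measurable f) (hf2 : ∫⁻ x, ‖f x‖ₑ ^ 2 ∂μT n < ∞)
    {φ : (Fin n → ℝ) → ℝ} (hφ : ContDiff ℝ (⊤ : ℕ∞) φ) (hp : ZPeriodic φ) (i : Fin n) :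
    Integrable (fun x => ∑ j, f x i * f x j * pd j φ x) (μT n) :=
  integrable_finsetSum _ fun j _ =>
    integrable_apply_mul_apply_mul hf hf2 (continuous_pd hφ j) (hp.pd j) i j

lemma exists_pairing_bound {φ : (Fin n → ℝ) → ℝ} (hφ : ContDiff ℝ (⊤ : ℕ∞) φ) (hp : ZPeriodic φ) :
    ∃ B : ℝ, 0 ≤ B ∧ ∀ f : (Fin n → ℝ) → (Fin n → ℝ), Measurable f →
      ∫⁻ x, ‖f x‖ₑ ^ 2 ∂μT n < ∞ → ∀ i, |pairing φ i f| ≤ B * ∫ x, (1 + ‖f x‖ ^ 2) ∂μT n ∧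
        |convPairing φ i f| ≤ B * ∫ x, (1 + ‖f x‖ ^ 2) ∂μT n := by
  obtain ⟨B, hB⟩ := hp.exists_bound hφ.continuous
  have hp' : ZPeriodic fun x => fun j => pd j φ x := fun x k => funext fun j => hp.pd j x k
  obtain ⟨B', hB'⟩ := hp'.exists_bound (continuous_pi fun j => continuous_pd hφ j)
  have hB0 : 0 ≤ B := (norm_nonneg _).trans (hB 0)
  have hB0' : 0 ≤ B' := (norm_nonneg _).trans (hB' 0)
  refine ⟨B + n * B', by positivity, fun f hf hf2 i => ?_⟩
  have hI := integrable_one_add_sq hf hf2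
  have h0 : 0 ≤ ∫ x, (1 + ‖f x‖ ^ 2) ∂μT n := integral_nonneg fun x => by positivity
  constructor
  · calc |pairing φ i f| ≤ ∫ x, B * (1 + ‖f x‖ ^ 2) ∂μT n := by
          rw [pairing, ← Real.norm_eq_abs]
          exact norm_integral_le_of_norm_le (hI.const_mul B)
            (Filter.Eventually.of_forall fun x => abs_apply_mul_le (hB x) _ _)
      _ = B * ∫ x, (1 + ‖f x‖ ^ 2) ∂μT n := integral_const_mul _ _
      _ ≤ _ := by gcongr; linarith [mul_nonneg (Nat.cast_nonneg (α := ℝ) n) hB0']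
  · calc |convPairing φ i f| ≤ ∫ x, (n * B') * (1 + ‖f x‖ ^ 2) ∂μT n := by
          rw [convPairing, ← Real.norm_eq_abs]
          refine norm_integral_le_of_norm_le (hI.const_mul _)
            (Filter.Eventually.of_forall fun x => ?_)
          refine (norm_sum_le _ _).trans ((Finset.sum_le_sum
            (g := fun _ => B' * (1 + ‖f x‖ ^ 2)) fun j _ => ?_).trans (by simp [mul_assoc]))
          exact abs_apply_mul_apply_mul_le
            ((norm_le_pi_norm (fun j => pd j φ x) j).trans (hB' x)) _ _ _
      _ = (n * B') * ∫ x, (1 + ‖f x‖ ^ 2) ∂μT n := integral_const_mul _ _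
      _ ≤ _ := by gcongr; linarith

lemma corr_mode (hf : Measurable f) (hf2 : ∫⁻ x, ‖f x‖ₑ ^ 2 ∂μT n < ∞) (k : Fin n → ℤ) :
    corr (mode k 0) f = ∑ i, (pairing (mode k 0) i f ^ 2 +
      pairing (mode k (-(Real.pi / 2))) i f ^ 2) := by
  have hi := fun s i => integrable_apply_mul hf hf2 (continuous_mode k s) (zperiodic_mode k s) i
  calc corr (mode k 0) f = ∫ z, ∑ i, ((f z.1 i * mode k 0 z.1) * (f z.2 i * mode k 0 z.2) +
        (f z.1 i * mode k (-(Real.pi / 2)) z.1) * (f z.2 i * mode k (-(Real.pi / 2)) z.2))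
        ∂(μT n).prod (μT n) := by
        refine integral_congr_ae (Filter.Eventually.of_forall fun z => ?_)
        simp only [mode_sub, zero_sub, Finset.mul_sum]
        exact Finset.sum_congr rfl fun i _ => by ring
    _ = _ := by
        rw [integral_finsetSum]
        · refine Finset.sum_congr rfl fun i _ => ?_
          rw [integral_add ((hi _ i).mul_prod (hi _ i)) ((hi _ i).mul_prod (hi _ i)),
            integral_prod_mul (μ := μT n) (ν := μT n) (fun x => f x i * mode k 0 x)
              (fun x => f x i * mode k 0 x),
            integral_prod_mul (μ := μT n) (ν := μT n) (fun x => f x i * mode k (-(Real.pi / 2)) x)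
              (fun x => f x i * mode k (-(Real.pi / 2)) x)]
          simp only [pairing, sq]
        · exact fun i _ => ((hi _ i).mul_prod (hi _ i)).add ((hi _ i).mul_prod (hi _ i))

lemma flux_mode (hf : Measurable f) (hf2 : ∫⁻ x, ‖f x‖ₑ ^ 2 ∂μT n < ∞) (k : Fin n → ℤ) :
    flux (fun j => pd j (mode k 0)) f = ∑ i, (
      pairing (mode k 0) i f * convPairing (mode k 0) i f +
      pairing (mode k (-(Real.pi / 2))) i f * convPairing (mode k (-(Real.pi / 2))) i f) := by
  have hi := fun s i => integrable_apply_mul hf hf2 (continuous_mode k s) (zperiodic_mode k s) i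
  have hc := fun s i => integrable_conv hf hf2 (contDiff_mode k s) (zperiodic_mode k s) i
  have hpd : ∀ j x y, pd j (mode k 0) (x - y) = pd j (mode k 0) x * mode k 0 y +
      pd j (mode k (-(Real.pi / 2))) x * mode k (-(Real.pi / 2)) y := by
    intro j x y
    simp only [pd_mode, mode_sub]
    ring_nf
  calc flux (fun j => pd j (mode k 0)) f = ∫ z, ∑ i,
        ((∑ j, f z.1 i * f z.1 j * pd j (mode k 0) z.1) * (f z.2 i * mode k 0 z.2) +
        (∑ j, f z.1 i * f z.1 j * pd j (mode k (-(Real.pi / 2))) z.1) *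
          (f z.2 i * mode k (-(Real.pi / 2)) z.2))
        ∂(μT n).prod (μT n) := by
        refine integral_congr_ae (Filter.Eventually.of_forall fun z => ?_)
        simp only [hpd, Finset.mul_sum, Finset.sum_mul, ← Finset.sum_add_distrib]
        refine Finset.sum_congr rfl fun i _ => Finset.sum_congr rfl fun j _ => by ring
    _ = _ := by
        rw [integral_finsetSum]
        · refine Finset.sum_congr rfl fun i _ => ?_
          rw [integral_add ((hc _ i).mul_prod (hi _ i)) ((hc _ i).mul_prod (hi _ i)),
            integral_prod_mul (μ := μT n) (ν := μT n)
              (fun x => ∑ j, f x i * f x j * pd j (mode k 0) x)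
              (fun x => f x i * mode k 0 x),
            integral_prod_mul (μ := μT n) (ν := μT n)
              (fun x => ∑ j, f x i * f x j * pd j (mode k (-(Real.pi / 2))) x)
              (fun x => f x i * mode k (-(Real.pi / 2)) x)]
          simp only [pairing, convPairing, mul_comm]
        · exact fun i _ => ((hc _ i).mul_prod (hi _ i)).add ((hc _ i).mul_prod (hi _ i))

lemma sum_mul_pairing_mode_eq_zero (hf : Measurable f) (hf2 : ∫⁻ x, ‖f x‖ₑ ^ 2 ∂μT n < ∞)
    (hdiv : ∀ φ : (Fin n → ℝ) → ℝ, ContDiff ℝ (⊤ : ℕ∞) φ → ZPeriodic φ →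
      ∫ x, (∑ i, f x i * pd i φ x) ∂μT n = 0) (k : Fin n → ℤ) (s : ℝ) :
    ∑ i, (k i : ℝ) * pairing (mode k s) i f = 0 := by
  have h := hdiv (mode k (s - Real.pi / 2)) (contDiff_mode _ _) (zperiodic_mode _ _)
  simp only [pd_mode, sub_add_cancel] at h
  have hi := fun i => integrable_apply_mul hf hf2 (continuous_mode k s) (zperiodic_mode k s) i
  have e : ∀ x i, f x i * (2 * Real.pi * k i * mode k s x) =
      2 * Real.pi * k i * (f x i * mode k s x) := fun x i => by ring
  simp only [e] at h
  rw [integral_finsetSum _ fun i _ => (hi i).const_mul _] at h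
  simp only [integral_const_mul, mul_assoc, ← Finset.mul_sum] at h
  simpa [Real.pi_ne_zero, pairing] using h

end Coeff

section Evolution

variable {n : ℕ} {T : ℝ} {u : ℝ → (Fin n → ℝ) → (Fin n → ℝ)} {u₀ : (Fin n → ℝ) → (Fin n → ℝ)}

lemma enorm_sq_le_ofReal_sum_sq (v : Fin n → ℝ) : ‖v‖ₑ ^ 2 ≤ ENNReal.ofReal (∑ i, v i ^ 2) := by
  rw [← ofReal_norm, ← ENNReal.ofReal_pow (norm_nonneg _)]
  refine ENNReal.ofReal_le_ofReal ?_
  have h0 : 0 ≤ ∑ i, v i ^ 2 := Finset.sum_nonneg fun i _ => sq_nonneg _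
  refine (Real.le_sqrt (norm_nonneg _) h0).1 ((pi_norm_le_iff_of_nonneg (Real.sqrt_nonneg _)).2
    fun i => ?_)
  rw [Real.norm_eq_abs]
  exact Real.abs_le_sqrt (Finset.single_le_sum (f := fun i => v i ^ 2)
    (fun i _ => sq_nonneg _) (Finset.mem_univ i))

lemma IsWeakSolutionHomEuler.exists_energy_bound (hw : IsWeakSolutionHomEuler n T u u₀) :
    ∃ C : ℝ≥0∞, C < ∞ ∧ ∀ᵐ t ∂volume.restrict (Set.Ioo 0 T), ∫⁻ x, ‖u t x‖ₑ ^ 2 ∂μT n ≤ C := by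
  have h := hw.energy_bdd
  simp only [lpNormENN, ENNReal.top_ne_zero, if_false, if_true] at h
  refine ⟨_, h, ?_⟩
  filter_upwards [ENNReal.ae_le_essSup (μ := volume.restrict (Set.Ioo 0 T))
    (fun t => ∫⁻ x in Box n, ENNReal.ofReal (∑ i, (u t x i)^2))] with t ht
  exact (lintegral_mono fun x => enorm_sq_le_ofReal_sum_sq _).trans ht

lemma IsWeakSolutionHomEuler.measurable_slice (hw : IsWeakSolutionHomEuler n T u u₀) (t : ℝ) :
    Measurable (u t) := hw.u_meas.of_uncurry_left

lemma IsWeakSolutionHomEuler.integrableOn_pairing (hw : IsWeakSolutionHomEuler n T u u₀)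
    {φ : (Fin n → ℝ) → ℝ} (hφ : ContDiff ℝ (⊤ : ℕ∞) φ) (hp : ZPeriodic φ) :
    ∃ B : ℝ, ∀ i,
      (IntegrableOn (fun t => pairing φ i (u t)) (Set.Ioo 0 T) ∧
        ∀ᵐ t ∂volume.restrict (Set.Ioo 0 T), ‖pairing φ i (u t)‖ ≤ B) ∧
      IntegrableOn (fun t => convPairing φ i (u t)) (Set.Ioo 0 T) := by
  obtain ⟨C, hC, hE⟩ := hw.exists_energy_bound
  obtain ⟨B, hB0, hB⟩ := exists_pairing_bound hφ hp
  have hu : Measurable fun p : ℝ × (Fin n → ℝ) => u p.1 p.2 := hw.u_meas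
  have hφm := hφ.continuous.measurable
  have hφm' := fun j => (continuous_pd hφ j).measurable
  have hbd : ∀ᵐ t ∂volume.restrict (Set.Ioo 0 T), ∫⁻ x, ‖u t x‖ₑ ^ 2 ∂μT n < ∞ ∧
      B * ∫ x, (1 + ‖u t x‖ ^ 2) ∂μT n ≤ B * (1 + C.toReal) := by
    filter_upwards [hE] with t ht
    have hfin := ht.trans_lt hC
    refine ⟨hfin, ?_⟩
    gcongr
    have hi := integrable_norm_pow (hw.measurable_slice t) hfin
    rw [integral_add (integrable_const _) hi]
    gcongr
    · simp
    · rw [integral_eq_lintegral_of_nonneg_ae (Filter.Eventually.of_forall fun x => by positivity)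
        hi.aestronglyMeasurable]
      refine ENNReal.toReal_mono hC.ne ((lintegral_mono fun x => ?_).trans ht)
      rw [ENNReal.ofReal_pow (norm_nonneg _), ofReal_norm]
  refine ⟨B * (1 + C.toReal), fun i => ?_⟩
  have b1 : ∀ᵐ t ∂volume.restrict (Set.Ioo 0 T), ‖pairing φ i (u t)‖ ≤ B * (1 + C.toReal) := by
    filter_upwards [hbd] with t ht
    exact ((hB _ (hw.measurable_slice t) ht.1 i).1).trans ht.2
  have b2 : ∀ᵐ t ∂volume.restrict (Set.Ioo 0 T), ‖convPairing φ i (u t)‖ ≤ B * (1 + C.toReal) := by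
    filter_upwards [hbd] with t ht
    exact ((hB _ (hw.measurable_slice t) ht.1 i).2).trans ht.2
  refine ⟨⟨Integrable.of_bound ?_ _ b1, b1⟩, Integrable.of_bound ?_ _ b2⟩
  · have : Measurable fun p : ℝ × (Fin n → ℝ) => u p.1 p.2 i * φ p.2 := by fun_prop
    exact (this.stronglyMeasurable.integral_prod_right' (ν := μT n)).aestronglyMeasurable
  · have : Measurable fun p : ℝ × (Fin n → ℝ) =>
        ∑ j, u p.1 p.2 i * u p.1 p.2 j * pd j φ p.2 := by fun_prop
    exact (this.stronglyMeasurable.integral_prod_right' (ν := μT n)).aestronglyMeasurable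

lemma IsWeakSolutionHomEuler.ae_pairing_eq (hw : IsWeakSolutionHomEuler n T u u₀) (hT : 0 < T)
    (hu₀ : ∫⁻ x, ‖u₀ x‖ₑ ^ 2 ∂μT n < ∞)
    {φ : (Fin n → ℝ) → ℝ} (hφ : ContDiff ℝ (⊤ : ℕ∞) φ) (hp : ZPeriodic φ) (a : Fin n → ℝ)
    (ha : ∀ x, ∑ i, a i * pd i φ x = 0) :
    ∀ᵐ t ∂volume.restrict (Set.Ioo 0 T), ∑ i, a i * pairing φ i (u t) =
      ∑ i, a i * pairing φ i u₀ + ∫ r in (0 : ℝ)..t, ∑ i, a i * convPairing φ i (u r) := by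
  obtain ⟨B, hB⟩ := hw.integrableOn_pairing hφ hp
  obtain ⟨C, hC, hE⟩ := hw.exists_energy_bound
  refine ae_eq_primitive_of_weak hT (integrable_finsetSum _ fun i _ => (hB i).1.1.const_mul _)
    (integrable_finsetSum _ fun i _ => (hB i).2.const_mul _) _ fun θ hθ ⟨T', hT', hz⟩ => ?_
  have hm := hw.momentum (fun t x i => θ t * (φ x * a i)) ?_ ?_ ⟨T', hT', ?_⟩ ?_
  · refine Eq.trans ?_ hm
    have hpd : ∀ t i j x, pd j (fun y => θ t * (φ y * a i)) x = θ t * (pd j φ x * a i) := by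
      intro t i j x
      have h1 : (fun y => θ t * (φ y * a i)) = (θ t * a i) • φ := by
        ext y
        simp only [Pi.smul_apply, smul_eq_mul]
        ring
      rw [h1, pd_smul hφ]
      ring
    have hdθ : ∀ t x i, deriv (fun s => θ s * (φ x * a i)) t = deriv θ t * (φ x * a i) := by
      intro t x i
      exact ((hθ.differentiable (by simp) t).hasDerivAt.mul_const _).deriv
    simp only [hpd, hdθ]
    congr 1
    · refine integral_congr_ae ?_
      filter_upwards [hE] with t ht
      have ht' := ht.trans_lt hC
      have hut := hw.measurable_slice t
      have i1 := fun i => integrable_apply_mul hut ht' hφ.continuous hp i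
      have i2 := fun i => integrable_conv hut ht' hφ hp i
      have e : ∀ x, (∑ i, u t x i * (deriv θ t * (φ x * a i)) +
          ∑ i, ∑ j, u t x i * u t x j * (θ t * (pd j φ x * a i))) =
          deriv θ t * (∑ i, a i * (u t x i * φ x)) +
          θ t * (∑ i, a i * ∑ j, u t x i * u t x j * pd j φ x) := by
        intro x
        simp only [Finset.mul_sum]
        congr 1
        · exact Finset.sum_congr rfl fun i _ => by ring
        · exact Finset.sum_congr rfl fun i _ => Finset.sum_congr rfl fun j _ => by ring
      simp only [e]
      change _ = ∫ x, _ ∂μT n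
      rw [integral_add ((integrable_finsetSum _ fun i _ => (i1 i).const_mul _).const_mul _)
        ((integrable_finsetSum _ fun i _ => (i2 i).const_mul _).const_mul _),
        integral_const_mul, integral_const_mul,
        integral_finsetSum _ fun i _ => (i1 i).const_mul _,
        integral_finsetSum _ fun i _ => (i2 i).const_mul _]
      simp only [integral_const_mul, pairing, convPairing]
    · have i1 := fun i => integrable_apply_mul hw.u₀_meas hu₀ hφ.continuous hp i
      have e : ∀ x, ∑ i, u₀ x i * (θ 0 * (φ x * a i)) = θ 0 * ∑ i, a i * (u₀ x i * φ x) := by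
        intro x
        rw [Finset.mul_sum]
        exact Finset.sum_congr rfl fun i _ => by ring
      simp only [e]
      change _ = ∫ x, _ ∂μT n
      rw [integral_const_mul, integral_finsetSum _ fun i _ => (i1 i).const_mul _]
      simp only [integral_const_mul, pairing]
  · have h1 : ContDiff ℝ (⊤ : ℕ∞) fun p : ℝ × (Fin n → ℝ) => θ p.1 := hθ.comp contDiff_fst
    have h2 : ContDiff ℝ (⊤ : ℕ∞) fun p : ℝ × (Fin n → ℝ) => φ p.2 := hφ.comp contDiff_snd
    exact contDiff_pi.2 fun i => h1.mul (h2.mul contDiff_const)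
  · intro t x k
    simp only [hp x k]
  · intro t ht x
    ext i
    simp [hz t ht]
  · intro t x
    have h2 : ∀ i, pd i (fun x => fun i => θ t * (φ x * a i)) x i = θ t * (a i * pd i φ x) := by
      intro i
      have h := ((hφ.differentiable (by simp) x).hasFDerivAt.smul_const a).const_smul (θ t)
      have h3 : fderiv ℝ (fun x => fun i => θ t * (φ x * a i)) x = _ := h.fderiv
      rw [pd, h3]
      simp [pd, mul_comm]
    simp only [h2, ← Finset.mul_sum, ha, mul_zero]

end Evolution

section Balance

variable {n : ℕ} {T : ℝ} {u : ℝ → (Fin n → ℝ) → (Fin n → ℝ)} {u₀ : (Fin n → ℝ) → (Fin n → ℝ)}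

/-- The matrix `δ_il - k_i k_l / |k|²` of the Leray projection at frequency `k`. -/
def leray (k : Fin n → ℤ) (i l : Fin n) : ℝ :=
  (if l = i then 1 else 0) - k i * k l / ∑ m, (k m : ℝ) ^ 2

lemma sum_leray_mul (k : Fin n → ℤ) (i : Fin n) (X : Fin n → ℝ) :
    ∑ l, leray k i l * X l = X i - k i / (∑ m, (k m : ℝ) ^ 2) * ∑ l, k l * X l := by
  simp only [leray, sub_mul, Finset.sum_sub_distrib, ite_mul, one_mul, zero_mul,
    Finset.sum_ite_eq', Finset.mem_univ, if_true, Finset.mul_sum]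
  congr 1
  exact Finset.sum_congr rfl fun l _ => by ring

lemma sum_leray_mul_self (k : Fin n → ℤ) (i : Fin n) : ∑ l, leray k i l * (k l : ℝ) = 0 := by
  rw [sum_leray_mul]
  by_cases h : ∑ m, (k m : ℝ) ^ 2 = 0
  · have h2 := (Finset.sum_eq_zero_iff_of_nonneg fun m _ => sq_nonneg _).1 h i (Finset.mem_univ i)
    have : (k i : ℝ) = 0 := by simpa using h2
    simp [this]
  · simp only [← sq]
    field_simp
    ring

lemma sum_leray_mul_pd_mode (k : Fin n → ℤ) (i : Fin n) (s : ℝ) (x : Fin n → ℝ) :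
    ∑ l, leray k i l * pd l (mode k s) x = 0 := by
  have e : ∀ l, leray k i l * pd l (mode k s) x =
      (leray k i l * k l) * (2 * Real.pi * mode k (s + Real.pi / 2) x) := fun l => by
    rw [pd_mode]
    ring
  simp only [e, ← Finset.sum_mul, sum_leray_mul_self, zero_mul]

lemma IsWeakSolutionHomEuler.ae_finite (hw : IsWeakSolutionHomEuler n T u u₀) :
    ∀ᵐ t ∂volume.restrict (Set.Ioo 0 T), ∫⁻ x, ‖u t x‖ₑ ^ 2 ∂μT n < ∞ := by
  obtain ⟨C, hC, hE⟩ := hw.exists_energy_bound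
  filter_upwards [hE] with t ht using ht.trans_lt hC

lemma IsWeakSolutionHomEuler.integrableOn_pairing_mul_convPairing
    (hw : IsWeakSolutionHomEuler n T u u₀) {φ : (Fin n → ℝ) → ℝ} (hφ : ContDiff ℝ (⊤ : ℕ∞) φ)
    (hp : ZPeriodic φ) (i l : Fin n) :
    IntegrableOn (fun t => pairing φ i (u t) * convPairing φ l (u t)) (Set.Ioo 0 T) := by
  obtain ⟨B, hB⟩ := hw.integrableOn_pairing hφ hp
  exact (hB l).2.bdd_mul (hB i).1.1.aestronglyMeasurable (hB i).1.2

lemma IsWeakSolutionHomEuler.ae_sum_sq_pairing (hw : IsWeakSolutionHomEuler n T u u₀) (hT : 0 < T)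
    (hu₀ : ∫⁻ x, ‖u₀ x‖ₑ ^ 2 ∂μT n < ∞)
    (hu₀div : ∀ φ : (Fin n → ℝ) → ℝ, ContDiff ℝ (⊤ : ℕ∞) φ → ZPeriodic φ →
      ∫ x in Box n, (∑ i, u₀ x i * pd i φ x) = 0) (k : Fin n → ℤ) (s : ℝ) :
    ∀ᵐ t ∂volume.restrict (Set.Ioo 0 T), ∑ i, pairing (mode k s) i (u t) ^ 2 =
      ∑ i, pairing (mode k s) i u₀ ^ 2 + 2 * ∫ r in Set.Ioo 0 t,
        ∑ i, pairing (mode k s) i (u r) * convPairing (mode k s) i (u r) := by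
  have hφ := contDiff_mode k s
  have hp := zperiodic_mode k s
  obtain ⟨B, hB⟩ := hw.integrableOn_pairing hφ hp
  set U : Fin n → ℝ → ℝ := fun i t => pairing (mode k s) i (u t) with hU
  set H : Fin n → ℝ → ℝ := fun i t => convPairing (mode k s) i (u t) with hH
  set c : Fin n → ℝ := fun i => pairing (mode k s) i u₀ with hc
  set g : Fin n → ℝ → ℝ := fun i t => ∑ l, leray k i l * H l t with hg
  have hgi : ∀ i, IntegrableOn (g i) (Set.Ioo 0 T) := fun i =>
    integrable_finsetSum _ fun l _ => (hB l).2.const_mul _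
  have hUg : ∀ i, IntegrableOn (fun t => U i t * g i t) (Set.Ioo 0 T) := fun i => by
    simp only [hg, Finset.mul_sum]
    refine integrable_finsetSum _ fun l _ => ?_
    refine ((hw.integrableOn_pairing_mul_convPairing hφ hp i l).const_mul (leray k i l)).congr
      (Filter.Eventually.of_forall fun t => ?_)
    simp only [hU, hH]
    ring
  have hc0 : ∑ l, (k l : ℝ) * c l = 0 := sum_mul_pairing_mode_eq_zero hw.u₀_meas hu₀ hu₀div k s
  have hU0 : ∀ᵐ t ∂volume.restrict (Set.Ioo 0 T), ∑ l, (k l : ℝ) * U l t = 0 := by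
    filter_upwards [hw.ae_finite, hw.div_free] with t h1 h2
    exact sum_mul_pairing_mode_eq_zero (hw.measurable_slice t) h1 h2 k s
  have hE : ∀ᵐ t ∂volume.restrict (Set.Ioo 0 T), ∀ i, U i t = c i + ∫ r in (0 : ℝ)..t, g i r := by
    rw [ae_all_iff]
    intro i
    filter_upwards [hw.ae_pairing_eq hT hu₀ hφ hp (leray k i) (sum_leray_mul_pd_mode k i s), hU0]
      with t h1 h2
    have e1 := sum_leray_mul k i fun l => U l t
    have e2 := sum_leray_mul k i c
    rw [h2] at e1
    rw [hc0] at e2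
    simp only [mul_zero, sub_zero] at e1 e2
    rw [← e1, ← e2]
    exact h1
  filter_upwards [hE, ae_restrict_mem measurableSet_Ioo] with t ht htm
  have hsub : Set.Ioo 0 t ⊆ Set.Ioo 0 T := Set.Ioo_subset_Ioo_right htm.2.le
  have hres : ∀ {p : ℝ → Prop}, (∀ᵐ r ∂volume.restrict (Set.Ioo 0 T), p r) →
      ∀ᵐ r ∂volume.restrict (Set.Ioo 0 t), p r := fun h =>
    ae_restrict_of_ae_restrict_of_subset hsub h
  have hsq : ∀ i, U i t ^ 2 = c i ^ 2 + 2 * ∫ r in Set.Ioo 0 t, U i r * g i r := by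
    intro i
    rw [ht i, sq_primitive htm.1 ((hgi i).mono_set hsub), ← setIntegral_Ioo_eq htm.1]
    congr 2
    refine integral_congr_ae ?_
    filter_upwards [hres hE] with r hr
    rw [hr i]
  change ∑ i, U i t ^ 2 = ∑ i, c i ^ 2 + 2 * ∫ r in Set.Ioo 0 t, ∑ i, U i r * H i r
  simp only [hsq, Finset.sum_add_distrib, ← Finset.mul_sum]
  rw [← integral_finsetSum _ fun i _ => (hUg i).mono_set hsub]
  congr 2
  refine integral_congr_ae ?_
  filter_upwards [hres hU0] with r hr
  have e : ∀ i, U i r * g i r = U i r * H i r - (k i * U i r) *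
      (1 / (∑ m, (k m : ℝ) ^ 2) * ∑ l, k l * H l r) := fun i => by
    simp only [hg, sum_leray_mul]
    ring
  simp only [e, Finset.sum_sub_distrib, ← Finset.sum_mul, hr, zero_mul, sub_zero]

variable (T u u₀) in
/-- Kernels `K` for which the regularized energy balance holds. -/
structure EnergyBalanced (K : (Fin n → ℝ) → ℝ) : Prop where
  contDiff : ContDiff ℝ (⊤ : ℕ∞) K
  zperiodic : ZPeriodic K
  even : ∀ x, K (-x) = K x
  integral_pd : ∀ j x, ∫ y, pd j K (x - y) ∂μT n = 0
  integrableOn_flux : IntegrableOn (fun t => flux (fun j => pd j K) (u t)) (Set.Ioo 0 T)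
  balance : ∀ᵐ t ∂volume.restrict (Set.Ioo 0 T), corr K (u t) = corr K u₀ +
    2 * ∫ r in Set.Ioo 0 t, flux (fun j => pd j K) (u r)

lemma IsWeakSolutionHomEuler.balanced_mode (hw : IsWeakSolutionHomEuler n T u u₀) (hT : 0 < T)
    (hu₀ : ∫⁻ x, ‖u₀ x‖ₑ ^ 2 ∂μT n < ∞)
    (hu₀div : ∀ φ : (Fin n → ℝ) → ℝ, ContDiff ℝ (⊤ : ℕ∞) φ → ZPeriodic φ →
      ∫ x in Box n, (∑ i, u₀ x i * pd i φ x) = 0) (k : Fin n → ℤ) :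
    EnergyBalanced T u u₀ (mode k 0) := by
  have hI := fun s i => hw.integrableOn_pairing_mul_convPairing (contDiff_mode k s)
    (zperiodic_mode k s) i i
  have hflux : ∀ᵐ t ∂volume.restrict (Set.Ioo 0 T), flux (fun j => pd j (mode k 0)) (u t) =
      ∑ i, pairing (mode k 0) i (u t) * convPairing (mode k 0) i (u t) +
      ∑ i, pairing (mode k (-(Real.pi / 2))) i (u t) *
        convPairing (mode k (-(Real.pi / 2))) i (u t) := by
    filter_upwards [hw.ae_finite] with t ht
    rw [flux_mode (hw.measurable_slice t) ht, Finset.sum_add_distrib]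
  have hIs := fun s => integrable_finsetSum Finset.univ fun i _ => hI s i
  refine ⟨contDiff_mode k 0, zperiodic_mode k 0, mode_zero_neg k, fun j x => ?_,
    ((hIs 0).add (hIs (-(Real.pi / 2)))).congr ?_, ?_⟩
  · by_cases hk : k = 0
    · simp [pd_mode, hk]
    · have e : ∀ y, mode k (0 + Real.pi / 2) (x - y) =
          mode (-k) (2 * Real.pi * ∑ i, k i * x i + (0 + Real.pi / 2)) y := fun y => by
        simp only [mode, Pi.sub_apply, Pi.neg_apply, Int.cast_neg, mul_sub, neg_mul,
          Finset.sum_sub_distrib, Finset.sum_neg_distrib]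
        congr 1
        ring
      simp only [pd_mode, integral_const_mul, e, integral_mode_eq_zero (neg_ne_zero.2 hk), mul_zero]
  · filter_upwards [hflux] with t ht
    rw [ht]
    rfl
  · filter_upwards [hw.ae_finite, ae_restrict_mem measurableSet_Ioo,
      hw.ae_sum_sq_pairing hT hu₀ hu₀div k 0,
      hw.ae_sum_sq_pairing hT hu₀ hu₀div k (-(Real.pi / 2))] with t ht htm h1 h2
    have hsub : Set.Ioo 0 t ⊆ Set.Ioo 0 T := Set.Ioo_subset_Ioo_right htm.2.le
    rw [corr_mode (hw.measurable_slice t) ht, corr_mode hw.u₀_meas hu₀, Finset.sum_add_distrib,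
      Finset.sum_add_distrib, h1, h2,
      integral_congr_ae (ae_restrict_of_ae_restrict_of_subset hsub hflux), integral_add]
    · ring
    · exact (hIs 0).mono_measure (Measure.restrict_mono_set _ hsub)
    · exact (hIs _).mono_measure (Measure.restrict_mono_set _ hsub)

lemma integrable_corr {f : (Fin n → ℝ) → (Fin n → ℝ)} (hf : Measurable f)
    (hf2 : ∫⁻ x, ‖f x‖ₑ ^ 2 ∂μT n < ∞) {K : (Fin n → ℝ) → ℝ} (hK : Continuous K)
    (hp : ZPeriodic K) :
    Integrable (fun z => K (z.1 - z.2) * ∑ l, f z.1 l * f z.2 l) ((μT n).prod (μT n)) := by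
  obtain ⟨C, hC⟩ := hp.exists_bound hK
  have hC0 : 0 ≤ C := (norm_nonneg _).trans (hC 0)
  have hm := hK.measurable
  refine integrable_prod_of_le hf hf2 (by fun_prop) (C * n) fun z => ?_
  rw [abs_mul]
  calc _ ≤ C * (n * (‖f z.1‖ * ‖f z.2‖)) := by
        gcongr
        exacts [hC _, abs_sum_mul_le _ _]
    _ = C * n * (‖f z.1‖ * ‖f z.2‖) := by ring
    _ ≤ _ := by
      gcongr
      · nlinarith [sq_nonneg (‖f z.1‖ - 1)]
      · nlinarith [sq_nonneg (‖f z.2‖ - 1)]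

lemma integrable_flux {f : (Fin n → ℝ) → (Fin n → ℝ)} (hf : Measurable f)
    (hf2 : ∫⁻ x, ‖f x‖ₑ ^ 2 ∂μT n < ∞) {κ : Fin n → (Fin n → ℝ) → ℝ}
    (hκ : ∀ j, Continuous (κ j)) (hp : ∀ j, ZPeriodic (κ j)) :
    Integrable (fun z => (∑ j, κ j (z.1 - z.2) * f z.1 j) * ∑ l, f z.1 l * f z.2 l)
      ((μT n).prod (μT n)) := by
  have hp' : ZPeriodic fun x => fun j => κ j x := fun x k => funext fun j => hp j x k
  obtain ⟨C, hC⟩ := hp'.exists_bound (continuous_pi hκ)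
  have hC0 : 0 ≤ C := (norm_nonneg _).trans (hC 0)
  have hm := fun j => (hκ j).measurable
  refine integrable_prod_of_le hf hf2 (by fun_prop) (n * C * n) fun z => ?_
  have h1 := abs_sum_mul_le (fun j => κ j (z.1 - z.2)) (f z.1)
  rw [abs_mul]
  calc _ ≤ (n * (C * ‖f z.1‖)) * (n * (‖f z.1‖ * ‖f z.2‖)) := by
        gcongr
        · exact h1.trans (by gcongr; exact hC _)
        · exact abs_sum_mul_le _ _
    _ = n * C * n * (‖f z.1‖ ^ 2 * ‖f z.2‖) := by ring
    _ ≤ _ := by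
      gcongr
      · linarith
      · nlinarith [sq_nonneg (‖f z.2‖ - 1)]

lemma corr_smul (c : ℝ) (K : (Fin n → ℝ) → ℝ) (f : (Fin n → ℝ) → (Fin n → ℝ)) :
    corr (c • K) f = c * corr K f := by
  simp only [corr, Pi.smul_apply, smul_eq_mul, mul_assoc, integral_const_mul]

lemma flux_smul (c : ℝ) (κ : Fin n → (Fin n → ℝ) → ℝ) (f : (Fin n → ℝ) → (Fin n → ℝ)) :
    flux (c • κ) f = c * flux κ f := by
  simp only [flux, Pi.smul_apply, smul_eq_mul, mul_assoc, integral_const_mul, ← Finset.mul_sum]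

lemma EnergyBalanced.smul {K : (Fin n → ℝ) → ℝ} (h : EnergyBalanced T u u₀ K) (c : ℝ) :
    EnergyBalanced T u u₀ (c • K) := by
  have e : (fun j => pd j (c • K)) = c • fun j => pd j K := by
    ext j x
    exact pd_smul h.contDiff c j x
  refine ⟨h.contDiff.const_smul c, fun x k => ?_, fun x => ?_, fun j x => ?_, ?_, ?_⟩
  · simp only [Pi.smul_apply, h.zperiodic x k]
  · simp only [Pi.smul_apply, h.even x]
  · simp only [pd_smul h.contDiff, integral_const_mul, h.integral_pd, mul_zero]
  · simp only [e, flux_smul]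
    exact h.integrableOn_flux.const_mul c
  · filter_upwards [h.balance] with t ht
    simp only [e, flux_smul, corr_smul, integral_const_mul, ht]
    ring

lemma EnergyBalanced.add (hw : IsWeakSolutionHomEuler n T u u₀)
    (hu₀ : ∫⁻ x, ‖u₀ x‖ₑ ^ 2 ∂μT n < ∞) {K L : (Fin n → ℝ) → ℝ}
    (hK : EnergyBalanced T u u₀ K) (hL : EnergyBalanced T u u₀ L) :
    EnergyBalanced T u u₀ (K + L) := by
  have hcorr : ∀ {f : (Fin n → ℝ) → (Fin n → ℝ)}, Measurable f → ∫⁻ x, ‖f x‖ₑ ^ 2 ∂μT n < ∞ →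
      corr (K + L) f = corr K f + corr L f := fun hf hf2 => by
    simp only [corr, Pi.add_apply, add_mul]
    exact integral_add (integrable_corr hf hf2 hK.contDiff.continuous hK.zperiodic)
      (integrable_corr hf hf2 hL.contDiff.continuous hL.zperiodic)
  have hflux : ∀ᵐ t ∂volume.restrict (Set.Ioo 0 T), flux (fun j => pd j (K + L)) (u t) =
      flux (fun j => pd j K) (u t) + flux (fun j => pd j L) (u t) := by
    filter_upwards [hw.ae_finite] with t ht
    simp only [flux, pd_add hK.contDiff hL.contDiff, add_mul, Finset.sum_add_distrib]
    exact integral_add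
      (integrable_flux (hw.measurable_slice t) ht (continuous_pd hK.contDiff) hK.zperiodic.pd)
      (integrable_flux (hw.measurable_slice t) ht (continuous_pd hL.contDiff) hL.zperiodic.pd)
  have hbd : ∀ {M : (Fin n → ℝ) → ℝ}, EnergyBalanced T u u₀ M → ∀ j x,
      Integrable (fun y => pd j M (x - y)) (μT n) := fun hM j x => by
    obtain ⟨C, hC⟩ := (hM.zperiodic.pd j).exists_bound (continuous_pd hM.contDiff j)
    have hc := (continuous_pd hM.contDiff j).comp
      (continuous_const.sub continuous_id : Continuous (x - ·))
    exact .of_bound hc.aestronglyMeasurable C (Filter.Eventually.of_forall fun y => hC _)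
  refine ⟨hK.contDiff.add hL.contDiff, fun x k => ?_, fun x => ?_, fun j x => ?_, ?_, ?_⟩
  · simp only [Pi.add_apply, hK.zperiodic x k, hL.zperiodic x k]
  · simp only [Pi.add_apply, hK.even x, hL.even x]
  · simp only [pd_add hK.contDiff hL.contDiff]
    rw [integral_add (hbd hK j x) (hbd hL j x), hK.integral_pd, hL.integral_pd, add_zero]
  · exact (hK.integrableOn_flux.add hL.integrableOn_flux).congr (hflux.mono fun t ht => ht.symm)
  · filter_upwards [hw.ae_finite, ae_restrict_mem measurableSet_Ioo, hK.balance, hL.balance]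
      with t ht htm h1 h2
    have hsub : Set.Ioo 0 t ⊆ Set.Ioo 0 T := Set.Ioo_subset_Ioo_right htm.2.le
    rw [hcorr (hw.measurable_slice t) ht, hcorr hw.u₀_meas hu₀, h1, h2,
      integral_congr_ae (ae_restrict_of_ae_restrict_of_subset hsub hflux),
      integral_add (hK.integrableOn_flux.mono_set hsub) (hL.integrableOn_flux.mono_set hsub)]
    ring

lemma IsWeakSolutionHomEuler.balanced_of_mem_span (hw : IsWeakSolutionHomEuler n T u u₀)
    (hT : 0 < T) (hu₀ : ∫⁻ x, ‖u₀ x‖ₑ ^ 2 ∂μT n < ∞)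
    (hu₀div : ∀ φ : (Fin n → ℝ) → ℝ, ContDiff ℝ (⊤ : ℕ∞) φ → ZPeriodic φ →
      ∫ x in Box n, (∑ i, u₀ x i * pd i φ x) = 0) {K : (Fin n → ℝ) → ℝ}
    (hK : K ∈ Submodule.span ℝ (Set.range fun k : Fin n → ℤ => mode k 0)) :
    EnergyBalanced T u u₀ K := by
  induction hK using Submodule.span_induction with
  | mem K hK =>
    obtain ⟨k, rfl⟩ := hK
    exact hw.balanced_mode hT hu₀ hu₀div k
  | zero => simpa using (hw.balanced_mode hT hu₀ hu₀div 0).smul 0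
  | add K L _ _ hK hL => exact hK.add hw hu₀ hL
  | smul c K _ hK => exact hK.smul c

end Balance

section Kernel

/-- The moment `∫₀¹ cos (π x) ^ (2 q) dx`. -/
def cosMoment (q : ℕ) : ℝ := ∫ x in Set.Ico (0 : ℝ) 1, Real.cos (Real.pi * x) ^ (2 * q)

lemma cosMoment_eq (q : ℕ) :
    cosMoment q = Real.pi⁻¹ * ∫ x in (0 : ℝ)..Real.pi, Real.cos x ^ (2 * q) := by
  rw [cosMoment, integral_Ico_eq_integral_Ioc, ← intervalIntegral.integral_of_le zero_le_one,
    intervalIntegral.integral_comp_mul_left (fun x => Real.cos x ^ (2 * q)) Real.pi_ne_zero]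
  simp

lemma cosMoment_zero : cosMoment 0 = 1 := by
  simp [cosMoment]

lemma cosMoment_succ (q : ℕ) : (2 * q + 2) * cosMoment (q + 1) = (2 * q + 1) * cosMoment q := by
  rw [cosMoment_eq, cosMoment_eq, show 2 * (q + 1) = 2 * q + 2 by ring, integral_cos_pow]
  have : (2 * q + 2 : ℝ) ≠ 0 := by positivity
  simp only [Real.sin_pi, Real.sin_zero, mul_zero, sub_zero, zero_div, zero_add]
  push_cast
  field_simp

lemma cosMoment_pos (q : ℕ) : 0 < cosMoment q := by
  induction q with
  | zero => simp [cosMoment_zero]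
  | succ q ih =>
    have h := cosMoment_succ q
    have h1 : 0 < (2 * q + 1 : ℝ) * cosMoment q := by positivity
    rw [← h] at h1
    exact pos_of_mul_pos_right h1 (by positivity)

/-- The one-dimensional Fejér-type kernel `cos (π x) ^ (2 (m + 1))`, normalized on the circle. -/
def cosKernel (m : ℕ) (x : ℝ) : ℝ := Real.cos (Real.pi * x) ^ (2 * (m + 1)) / cosMoment (m + 1)

/-- The derivative of `cosKernel`. -/
def cosKernelDeriv (m : ℕ) (x : ℝ) : ℝ :=
  -(2 * (m + 1) * Real.pi * Real.cos (Real.pi * x) ^ (2 * m + 1) * Real.sin (Real.pi * x)) /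
    cosMoment (m + 1)

lemma hasDerivAt_cosKernel (m : ℕ) (x : ℝ) : HasDerivAt (cosKernel m) (cosKernelDeriv m x) x := by
  have h1 : HasDerivAt (fun x : ℝ => Real.pi * x) Real.pi x := by
    simpa using (hasDerivAt_id x).const_mul Real.pi
  have h2 := (h1.cos.pow (2 * (m + 1))).div_const (cosMoment (m + 1))
  have h3 : HasDerivAt (cosKernel m) _ x := h2
  refine h3.congr_deriv ?_
  rw [cosKernelDeriv, show 2 * (m + 1) - 1 = 2 * m + 1 by omega]
  push_cast
  ring

lemma cosKernel_nonneg (m : ℕ) (x : ℝ) : 0 ≤ cosKernel m x :=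
  div_nonneg (by rw [pow_mul]; positivity) (cosMoment_pos _).le

@[fun_prop]
lemma continuous_cosKernel (m : ℕ) : Continuous (cosKernel m) := by
  unfold cosKernel
  fun_prop

@[fun_prop]
lemma continuous_cosKernelDeriv (m : ℕ) : Continuous (cosKernelDeriv m) := by
  unfold cosKernelDeriv
  fun_prop

lemma integrableOn_Ico_of_continuous {f : ℝ → ℝ} (hf : Continuous f) :
    Integrable f (volume.restrict (Set.Ico (0 : ℝ) 1)) :=
  (hf.integrableOn_Icc (a := 0) (b := 1)).mono_set Set.Ico_subset_Icc_self

lemma integral_cosKernel (m : ℕ) : ∫ x in Set.Ico (0 : ℝ) 1, cosKernel m x = 1 := by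
  simp only [cosKernel, integral_div]
  exact div_self (cosMoment_pos _).ne'

lemma integral_cos_pow_mul_sin_sq (q : ℕ) :
    ∫ x in Set.Ico (0 : ℝ) 1, Real.cos (Real.pi * x) ^ (2 * q) * |Real.sin (Real.pi * x)| ^ 2 =
      cosMoment q - cosMoment (q + 1) := by
  rw [cosMoment, cosMoment, ← integral_sub (integrableOn_Ico_of_continuous (by fun_prop))
    (integrableOn_Ico_of_continuous (by fun_prop))]
  congr 1
  ext x
  rw [sq_abs, Real.sin_sq]
  ring

lemma integral_cos_pow_mul_sin_four (q : ℕ) :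
    ∫ x in Set.Ico (0 : ℝ) 1, Real.cos (Real.pi * x) ^ (2 * q) * |Real.sin (Real.pi * x)| ^ 4 =
      cosMoment q - 2 * cosMoment (q + 1) + cosMoment (q + 2) := by
  rw [cosMoment, cosMoment, cosMoment, ← integral_const_mul,
    ← integral_sub (integrableOn_Ico_of_continuous (by fun_prop))
    (integrableOn_Ico_of_continuous (by fun_prop)),
    ← integral_add (integrableOn_Ico_of_continuous (by fun_prop))
    (integrableOn_Ico_of_continuous (by fun_prop))]
  congr 1
  ext x
  rw [show |Real.sin (Real.pi * x)| ^ 4 = (|Real.sin (Real.pi * x)| ^ 2) ^ 2 by ring, sq_abs,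
    Real.sin_sq]
  ring

lemma integral_cosKernel_mul_sin_sq_le (m : ℕ) :
    ∫ x in Set.Ico (0 : ℝ) 1, cosKernel m x * |Real.sin (Real.pi * x)| ^ 2 ≤ 1 / (m + 1) := by
  have hZ := cosMoment_pos (m + 1)
  have h1 := cosMoment_succ (m + 1)
  have h := integral_cos_pow_mul_sin_sq (m + 1)
  simp only [cosKernel, div_mul_eq_mul_div, integral_div]
  rw [h, div_le_div_iff₀ hZ (by positivity)]
  push_cast at h1
  nlinarith [cosMoment_pos (m + 2)]

lemma integral_cosKernel_mul_sin_le (m : ℕ) :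
    ∫ x in Set.Ico (0 : ℝ) 1, cosKernel m x * |Real.sin (Real.pi * x)| ≤ 1 / Real.sqrt (m + 1) := by
  set r := Real.sqrt (m + 1) with hr
  have hr0 : 0 < r := Real.sqrt_pos.2 (by positivity)
  have hr2 : r ^ 2 = m + 1 := Real.sq_sqrt (by positivity)
  have hle : ∀ x, cosKernel m x * |Real.sin (Real.pi * x)| ≤
      (1 / (2 * r)) * cosKernel m x + (r / 2) * (cosKernel m x * |Real.sin (Real.pi * x)| ^ 2) := by
    intro x
    set s := |Real.sin (Real.pi * x)|
    have : s ≤ 1 / (2 * r) + r / 2 * s ^ 2 := by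
      have : 1 / (2 * r) + r / 2 * s ^ 2 - s = (1 - r * s) ^ 2 / (2 * r) := by
        field_simp
        ring
      have h2 : 0 ≤ (1 - r * s) ^ 2 / (2 * r) := by positivity
      linarith
    calc _ ≤ cosKernel m x * (1 / (2 * r) + r / 2 * s ^ 2) := by
          gcongr
          exact cosKernel_nonneg m x
      _ = _ := by ring
  refine (integral_mono (integrableOn_Ico_of_continuous (by fun_prop))
    (integrableOn_Ico_of_continuous (by fun_prop)) hle).trans ?_
  rw [integral_add (integrableOn_Ico_of_continuous (by fun_prop))
    (integrableOn_Ico_of_continuous (by fun_prop)), integral_const_mul, integral_const_mul,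
    integral_cosKernel]
  calc _ ≤ 1 / (2 * r) * 1 + r / 2 * (1 / (m + 1)) := by
        gcongr
        exact integral_cosKernel_mul_sin_sq_le m
    _ = 1 / r := by
        rw [← hr2]
        field_simp
        norm_num

lemma abs_cosKernelDeriv_le (m : ℕ) (x : ℝ) : |cosKernelDeriv m x| ≤
    2 * (m + 1) * Real.pi / cosMoment (m + 1) *
      (Real.cos (Real.pi * x) ^ (2 * m) * |Real.sin (Real.pi * x)|) := by
  have hZ := cosMoment_pos (m + 1)
  have h1 : |Real.cos (Real.pi * x) ^ (2 * m + 1)| ≤ Real.cos (Real.pi * x) ^ (2 * m) := by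
    rw [pow_succ, abs_mul, pow_mul, abs_of_nonneg (a := (Real.cos (Real.pi * x) ^ 2) ^ m)
      (by positivity)]
    exact mul_le_of_le_one_right (by positivity) (Real.abs_cos_le_one _)
  rw [cosKernelDeriv, abs_div, abs_neg, abs_mul, abs_mul, abs_of_pos hZ,
    abs_of_nonneg (a := 2 * ((m : ℝ) + 1) * Real.pi) (by positivity), div_mul_eq_mul_div]
  gcongr ?_ / _
  rw [mul_assoc]
  gcongr

lemma integral_abs_cosKernelDeriv_mul_sin_le (m : ℕ) :
    ∫ x in Set.Ico (0 : ℝ) 1, |cosKernelDeriv m x| * |Real.sin (Real.pi * x)| ≤ 2 * Real.pi := by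
  have hZ := cosMoment_pos (m + 1)
  have hle : ∀ x, |cosKernelDeriv m x| * |Real.sin (Real.pi * x)| ≤
      2 * (m + 1) * Real.pi / cosMoment (m + 1) *
        (Real.cos (Real.pi * x) ^ (2 * m) * |Real.sin (Real.pi * x)| ^ 2) := fun x => by
    calc _ ≤ _ := mul_le_mul_of_nonneg_right (abs_cosKernelDeriv_le m x) (abs_nonneg _)
      _ = _ := by ring
  refine (integral_mono (integrableOn_Ico_of_continuous (by fun_prop))
    (integrableOn_Ico_of_continuous (by fun_prop)) hle).trans ?_
  rw [integral_const_mul, integral_cos_pow_mul_sin_sq, div_mul_eq_mul_div, div_le_iff₀ hZ]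
  have h := cosMoment_succ m
  have h2 : (2 * m + 1) * (cosMoment m - cosMoment (m + 1)) = cosMoment (m + 1) := by linarith
  have h3 : 2 * (m + 1) * (cosMoment m - cosMoment (m + 1)) ≤ 2 * cosMoment (m + 1) := by
    have : 0 ≤ m * (cosMoment m - cosMoment (m + 1)) := by
      refine mul_nonneg m.cast_nonneg ?_
      nlinarith [(m.cast_nonneg : (0 : ℝ) ≤ m)]
    linarith
  nlinarith [Real.pi_pos]

lemma integral_abs_cosKernelDeriv_mul_sin_cube_le (m : ℕ) :
    ∫ x in Set.Ico (0 : ℝ) 1, |cosKernelDeriv m x| * |Real.sin (Real.pi * x)| ^ 3 ≤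
      3 * Real.pi / (m + 1) := by
  have hZ := cosMoment_pos (m + 1)
  have hle : ∀ x, |cosKernelDeriv m x| * |Real.sin (Real.pi * x)| ^ 3 ≤
      2 * (m + 1) * Real.pi / cosMoment (m + 1) *
        (Real.cos (Real.pi * x) ^ (2 * m) * |Real.sin (Real.pi * x)| ^ 4) := fun x => by
    calc _ ≤ _ := mul_le_mul_of_nonneg_right (abs_cosKernelDeriv_le m x) (by positivity)
      _ = _ := by ring
  refine (integral_mono (integrableOn_Ico_of_continuous (by fun_prop))
    (integrableOn_Ico_of_continuous (by fun_prop)) hle).trans ?_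
  rw [integral_const_mul, integral_cos_pow_mul_sin_four]
  have h := cosMoment_succ m
  have h' := cosMoment_succ (m + 1)
  push_cast at h'
  have e1 : cosMoment m = (2 * m + 2) / (2 * m + 1) * cosMoment (m + 1) := by
    field_simp
    linarith
  have e2 : cosMoment (m + 2) = (2 * m + 3) / (2 * m + 4) * cosMoment (m + 1) := by
    field_simp
    linarith
  rw [e1, e2]
  have e3 : 2 * (m + 1) * Real.pi / cosMoment (m + 1) * ((2 * m + 2) / (2 * m + 1) *
      cosMoment (m + 1) - 2 * cosMoment (m + 1) + (2 * m + 3) / (2 * m + 4) * cosMoment (m + 1)) =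
      3 * Real.pi * ((m + 1) / ((2 * m + 1) * (m + 2))) := by
    field_simp
    ring
  rw [e3, div_eq_mul_one_div (3 * Real.pi)]
  refine mul_le_mul_of_nonneg_left ?_ (by positivity)
  rw [div_le_div_iff₀ (by positivity) (by positivity)]
  nlinarith [(m.cast_nonneg : (0 : ℝ) ≤ m)]

lemma integral_abs_cosKernelDeriv_le (m : ℕ) :
    ∫ x in Set.Ico (0 : ℝ) 1, |cosKernelDeriv m x| ≤ 3 * Real.pi * Real.sqrt (m + 1) := by
  have hZ := cosMoment_pos (m + 1)
  set r := Real.sqrt (m + 1) with hr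
  have hr0 : 0 < r := Real.sqrt_pos.2 (by positivity)
  have hr2 : r ^ 2 = m + 1 := Real.sq_sqrt (by positivity)
  have hle : ∀ x, |cosKernelDeriv m x| ≤ 2 * (m + 1) * Real.pi / cosMoment (m + 1) *
      (1 / (2 * r) * Real.cos (Real.pi * x) ^ (2 * m) +
        r / 2 * (Real.cos (Real.pi * x) ^ (2 * m) * |Real.sin (Real.pi * x)| ^ 2)) := by
    intro x
    refine (abs_cosKernelDeriv_le m x).trans ?_
    set s := |Real.sin (Real.pi * x)|
    have : s ≤ 1 / (2 * r) + r / 2 * s ^ 2 := by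
      have : 1 / (2 * r) + r / 2 * s ^ 2 - s = (1 - r * s) ^ 2 / (2 * r) := by
        field_simp
        ring
      have h2 : 0 ≤ (1 - r * s) ^ 2 / (2 * r) := by positivity
      linarith
    gcongr
    calc _ ≤ Real.cos (Real.pi * x) ^ (2 * m) * (1 / (2 * r) + r / 2 * s ^ 2) := by
          gcongr
          rw [pow_mul]
          positivity
      _ = _ := by ring
  refine (integral_mono (integrableOn_Ico_of_continuous (by fun_prop))
    (integrableOn_Ico_of_continuous (by fun_prop)) hle).trans ?_
  rw [integral_const_mul, integral_add (integrableOn_Ico_of_continuous (by fun_prop))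
    (integrableOn_Ico_of_continuous (by fun_prop)), integral_const_mul, integral_const_mul,
    integral_cos_pow_mul_sin_sq, ← cosMoment]
  have h := cosMoment_succ m
  have e1 : cosMoment m = (2 * m + 2) / (2 * m + 1) * cosMoment (m + 1) := by
    field_simp
    linarith
  rw [e1]
  have e3 : 2 * (m + 1) * Real.pi / cosMoment (m + 1) *
      (1 / (2 * r) * ((2 * m + 2) / (2 * m + 1) * cosMoment (m + 1)) +
        r / 2 * ((2 * m + 2) / (2 * m + 1) * cosMoment (m + 1) - cosMoment (m + 1))) =
      3 * Real.pi * r * ((m + 1) / (2 * m + 1)) := by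
    rw [← hr2]
    have : (2 * m + 1 : ℝ) ≠ 0 := by positivity
    field_simp
    rw [hr2]
    ring
  rw [e3]
  refine mul_le_of_le_one_right (by positivity) ?_
  rw [div_le_one (by positivity)]
  linarith [(m.cast_nonneg : (0 : ℝ) ≤ m)]

end Kernel

section TorusKernel

variable {n : ℕ}

lemma span_mode_mul_mem {K L : (Fin n → ℝ) → ℝ}
    (hK : K ∈ Submodule.span ℝ (Set.range fun k : Fin n → ℤ => mode k 0))
    (hL : L ∈ Submodule.span ℝ (Set.range fun k : Fin n → ℤ => mode k 0)) :
    K * L ∈ Submodule.span ℝ (Set.range fun k : Fin n → ℤ => mode k 0) := by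
  have h := Submodule.mul_mem_mul hK hL
  rw [Submodule.span_mul_span] at h
  refine Submodule.span_le.2 ?_ h
  rintro _ ⟨_, ⟨k, rfl⟩, _, ⟨l, rfl⟩, rfl⟩
  change mode k 0 * mode l 0 ∈ _
  rw [mode_mul_mode]
  exact add_mem (Submodule.smul_mem _ _ (Submodule.subset_span ⟨_, rfl⟩))
    (Submodule.smul_mem _ _ (Submodule.subset_span ⟨_, rfl⟩))

variable (n) in
/-- The algebra of even trigonometric polynomials. -/
def cosAlgebra : Subalgebra ℝ ((Fin n → ℝ) → ℝ) :=
  (Submodule.span ℝ (Set.range fun k : Fin n → ℤ => mode k 0)).toSubalgebra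
    (Submodule.subset_span ⟨0, by ext x; simp [mode]⟩) fun _ _ => span_mode_mul_mem

variable (n) in
/-- The tensorized kernel `∏ i, cosKernel m (ξ i)` on the torus. -/
def torusKernel (m : ℕ) (ξ : Fin n → ℝ) : ℝ := ∏ i, cosKernel m (ξ i)

lemma torusKernel_mem_span (m : ℕ) :
    torusKernel n m ∈ Submodule.span ℝ (Set.range fun k : Fin n → ℤ => mode k 0) := by
  change _ ∈ cosAlgebra n
  have e : torusKernel n m = ∏ i, (1 / cosMoment (m + 1)) •
      ((1 / 2 : ℝ) • (1 + mode (Pi.single i (1 : ℤ)) 0)) ^ (m + 1) := by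
    ext ξ
    rw [Finset.prod_apply]
    refine Finset.prod_congr rfl fun i _ => ?_
    have e1 : mode (Pi.single i (1 : ℤ)) 0 ξ = Real.cos (2 * (Real.pi * ξ i)) := by
      simp [mode, Pi.single_apply, mul_assoc]
    simp only [Pi.smul_apply, Pi.pow_apply, Pi.add_apply, Pi.one_apply, e1, smul_eq_mul, cosKernel,
      Real.cos_two_mul, pow_mul]
    ring
  rw [e]
  refine prod_mem fun i _ => Subalgebra.smul_mem _ (pow_mem (Subalgebra.smul_mem _
    (add_mem (one_mem _) ?_) _) _) _
  exact Submodule.subset_span ⟨_, rfl⟩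

lemma torusKernel_nonneg (m : ℕ) (ξ : Fin n → ℝ) : 0 ≤ torusKernel n m ξ :=
  Finset.prod_nonneg fun _ _ => cosKernel_nonneg _ _

lemma pd_torusKernel (m : ℕ) (j : Fin n) (ξ : Fin n → ℝ) :
    pd j (torusKernel n m) ξ =
      ∏ i, (if i = j then cosKernelDeriv m (ξ i) else cosKernel m (ξ i)) := by
  have h : HasFDerivAt (torusKernel n m) (∑ i, (∏ l ∈ Finset.univ.erase i, cosKernel m (ξ l)) •
      (cosKernelDeriv m (ξ i) • ContinuousLinearMap.proj (R := ℝ) (φ := fun _ => ℝ) i)) ξ := by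
    refine HasFDerivAt.finsetProd (g := fun i (y : Fin n → ℝ) => cosKernel m (y i))
      fun i _ => ?_
    exact (hasDerivAt_cosKernel m (ξ i)).comp_hasFDerivAt ξ
      (hasFDerivAt_apply (𝕜 := ℝ) (F' := fun _ : Fin n => ℝ) i ξ)
  rw [pd, h.fderiv, ← Finset.mul_prod_erase _ _ (Finset.mem_univ j)]
  simp only [_root_.sum_apply, _root_.smul_apply, ContinuousLinearMap.proj_apply, Pi.single_apply,
    smul_eq_mul, mul_ite, mul_one, mul_zero, Finset.sum_ite_eq', Finset.mem_univ, if_true]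
  rw [mul_comm]
  congr 1
  exact Finset.prod_congr rfl fun i hi => (if_neg (Finset.ne_of_mem_erase hi)).symm

lemma integral_prod_apply (g : Fin n → ℝ → ℝ) :
    ∫ ξ, ∏ i, g i (ξ i) ∂μT n = ∏ i, ∫ x in Set.Ico (0 : ℝ) 1, g i x := by
  rw [muT_eq_pi]
  exact integral_fintype_prod_eq_prod _

lemma integral_torusKernel (m : ℕ) : ∫ ξ, torusKernel n m ξ ∂μT n = 1 := by
  simp only [torusKernel]
  rw [integral_prod_apply fun _ => cosKernel m]
  simp [integral_cosKernel]

lemma integral_torusKernel_mul_sin_sq_le (m : ℕ) (l : Fin n) :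
    ∫ ξ, torusKernel n m ξ * |Real.sin (Real.pi * ξ l)| ^ 2 ∂μT n ≤ 1 / (m + 1) := by
  have e : ∀ ξ : Fin n → ℝ, torusKernel n m ξ * |Real.sin (Real.pi * ξ l)| ^ 2 =
      ∏ i, (cosKernel m (ξ i) * if i = l then |Real.sin (Real.pi * ξ i)| ^ 2 else 1) := fun ξ => by
    rw [Finset.prod_mul_distrib, Finset.prod_ite_eq']
    simp [torusKernel]
  simp only [e]
  rw [integral_prod_apply fun i x =>
    cosKernel m x * if i = l then |Real.sin (Real.pi * x)| ^ 2 else 1,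
    Finset.prod_eq_single l (fun i _ hi => by simp [hi, integral_cosKernel]) (by simp)]
  simpa using integral_cosKernel_mul_sin_sq_le m

lemma integral_abs_pd_torusKernel_mul (m : ℕ) (j l : Fin n) (p : ℕ) :
    ∫ ξ, |pd j (torusKernel n m) ξ| * |Real.sin (Real.pi * ξ l)| ^ p ∂μT n =
      if j = l then ∫ x in Set.Ico (0 : ℝ) 1, |cosKernelDeriv m x| * |Real.sin (Real.pi * x)| ^ p
      else (∫ x in Set.Ico (0 : ℝ) 1, |cosKernelDeriv m x|) *
        ∫ x in Set.Ico (0 : ℝ) 1, cosKernel m x * |Real.sin (Real.pi * x)| ^ p := by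
  have e : ∀ ξ : Fin n → ℝ, |pd j (torusKernel n m) ξ| * |Real.sin (Real.pi * ξ l)| ^ p =
      ∏ i, ((if i = j then |cosKernelDeriv m (ξ i)| else cosKernel m (ξ i)) *
        if i = l then |Real.sin (Real.pi * ξ i)| ^ p else 1) := fun ξ => by
    rw [Finset.prod_mul_distrib, Finset.prod_ite_eq', pd_torusKernel, Finset.abs_prod]
    simp only [Finset.mem_univ, if_true]
    congr 1
    refine Finset.prod_congr rfl fun i _ => ?_
    split_ifs
    · rfl
    · exact abs_of_nonneg (cosKernel_nonneg _ _)
  simp only [e]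
  rw [integral_prod_apply fun i x => (if i = j then |cosKernelDeriv m x| else cosKernel m x) *
        if i = l then |Real.sin (Real.pi * x)| ^ p else 1]
  split_ifs with h
  · subst h
    rw [Finset.prod_eq_single j (fun i _ hi => by simp [hi, integral_cosKernel]) (by simp)]
    simp
  · rw [Finset.prod_eq_mul j l h (fun i _ hi => by simp [hi.1, hi.2, integral_cosKernel])
      (by simp) (by simp)]
    simp [h, Ne.symm h]

lemma integral_abs_pd_torusKernel_mul_sin_le (m : ℕ) (j l : Fin n) :
    ∫ ξ, |pd j (torusKernel n m) ξ| * |Real.sin (Real.pi * ξ l)| ∂μT n ≤ 3 * Real.pi := by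
  have h := integral_abs_pd_torusKernel_mul m j l 1
  simp only [pow_one] at h
  rw [h]
  have hr : 0 < Real.sqrt (m + 1) := Real.sqrt_pos.2 (by positivity)
  split_ifs
  · linarith [integral_abs_cosKernelDeriv_mul_sin_le m, Real.pi_pos]
  · calc _ ≤ (3 * Real.pi * Real.sqrt (m + 1)) * (1 / Real.sqrt (m + 1)) := by
          refine mul_le_mul (integral_abs_cosKernelDeriv_le m) (integral_cosKernel_mul_sin_le m)
            (integral_nonneg fun x => mul_nonneg (cosKernel_nonneg m x) (abs_nonneg _))
            (by positivity)
      _ = _ := by field_simp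

lemma integral_abs_pd_torusKernel_mul_sin_cube_le (m : ℕ) (j l : Fin n) :
    ∫ ξ, |pd j (torusKernel n m) ξ| * |Real.sin (Real.pi * ξ l)| ^ 3 ∂μT n ≤
      3 * Real.pi / Real.sqrt (m + 1) := by
  rw [integral_abs_pd_torusKernel_mul m j l 3]
  have hr : 0 < Real.sqrt (m + 1) := Real.sqrt_pos.2 (by positivity)
  have hr2 : Real.sqrt (m + 1) ^ 2 = m + 1 := Real.sq_sqrt (by positivity)
  split_ifs
  · refine (integral_abs_cosKernelDeriv_mul_sin_cube_le m).trans ?_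
    gcongr
    nlinarith [Real.one_le_sqrt.2 (by linarith [m.cast_nonneg (α := ℝ)] : (1 : ℝ) ≤ m + 1)]
  · calc _ ≤ (3 * Real.pi * Real.sqrt (m + 1)) * (1 / (m + 1)) := by
          refine mul_le_mul (integral_abs_cosKernelDeriv_le m) ?_
            (integral_nonneg fun x => mul_nonneg (cosKernel_nonneg m x) (by positivity))
            (by positivity)
          refine (integral_mono (integrableOn_Ico_of_continuous (by fun_prop))
            (integrableOn_Ico_of_continuous (by fun_prop)) fun x => ?_).trans
            (integral_cosKernel_mul_sin_sq_le m)
          refine mul_le_mul_of_nonneg_left ?_ (cosKernel_nonneg m x)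
          exact pow_le_pow_of_le_one (abs_nonneg _) (Real.abs_sin_le_one _) (by norm_num)
      _ = _ := by
          rw [show (1 : ℝ) / (m + 1) = 1 / Real.sqrt (m + 1) ^ 2 by rw [hr2]]
          field_simp

end TorusKernel

section Translation

variable {n : ℕ}

lemma ZPeriodic.setLIntegral_box_lt_top {g : (Fin n → ℝ) → ℝ≥0∞} (hg : ZPeriodic g)
    (h : ∫⁻ x, g x ∂μT n < ∞) :
    ∫⁻ x in Set.univ.pi fun _ : Fin n => Set.Ico (-1 : ℝ) 2, g x < ∞ := by
  let a : (Fin n → Fin 3) → Fin n → ℝ := fun k i => (((k i : ℕ) : ℤ) - 1 : ℤ)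
  have hsub : (Set.univ.pi fun _ : Fin n => Set.Ico (-1 : ℝ) 2) ⊆
      ⋃ k, (fun x => x + a k) '' Box n := by
    intro x hx
    have hx : ∀ i, -1 ≤ x i ∧ x i < 2 := fun i => hx i trivial
    have hf : ∀ i, ∃ j : Fin 3, (((j : ℕ) : ℤ) - 1 : ℤ) = ⌊x i⌋ := fun i => by
      have h1 : -1 ≤ ⌊x i⌋ := Int.le_floor.2 (by exact_mod_cast (hx i).1)
      have h2 : ⌊x i⌋ < 2 := Int.floor_lt.2 (by exact_mod_cast (hx i).2)
      exact ⟨⟨(⌊x i⌋ + 1).toNat, by omega⟩, by simp; omega⟩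
    choose k hk using hf
    refine Set.mem_iUnion.2 ⟨k, fun i => Int.fract (x i), fun i _ =>
      ⟨Int.fract_nonneg _, Int.fract_lt_one _⟩, ?_⟩
    ext i
    simp only [a, Pi.add_apply, hk, Int.fract_add_floor]
  refine (lintegral_mono_set hsub).trans_lt ((lintegral_iUnion_le _ _).trans_lt ?_)
  rw [tsum_fintype]
  refine ENNReal.sum_lt_top.2 fun k _ => ?_
  rw [← (measurePreserving_add_right (volume : Measure (Fin n → ℝ)) (a k)).setLIntegral_comp_emb
    (measurableEmbedding_addRight (a k)) g (Box n)]
  exact (hg.lintegral_add_right (a k)).trans_lt h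

lemma ZPeriodic.tendsto_lintegral_translate {f : (Fin n → ℝ) → (Fin n → ℝ)} (hf : Measurable f)
    (hfp : ZPeriodic f) (hf2 : ∫⁻ x, ‖f x‖ₑ ^ 2 ∂μT n < ∞) :
    Filter.Tendsto (fun ξ => ∫⁻ x, ‖f (x + ξ) - f x‖ₑ ^ 2 ∂μT n) (nhds 0) (nhds 0) := by
  set B : Set (Fin n → ℝ) := Set.univ.pi fun _ : Fin n => Set.Ico (-1 : ℝ) 2 with hB
  have hBm : MeasurableSet B := MeasurableSet.univ_pi fun _ => measurableSet_Ico
  have hF : MemLp (B.indicator f) 2 volume := by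
    refine (memLp_indicator_iff_restrict hBm).2 ⟨hf.aestronglyMeasurable, ?_⟩
    rw [eLpNorm_lt_top_iff_lintegral_rpow_enorm_lt_top (by norm_num) (by norm_num)]
    have := ZPeriodic.setLIntegral_box_lt_top (g := fun x => ‖f x‖ₑ ^ 2)
      (fun x k => by simp only [hfp x k]) hf2
    simpa using this
  have : Fact ((2 : ℝ≥0∞) ≠ ∞) := ⟨by norm_num⟩
  have hc : Continuous fun ξ : Fin n → ℝ => DomAddAct.mk ξ +ᵥ hF.toLp (B.indicator f) :=
    (DomAddAct.continuous_mk).vadd continuous_const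
  have ht := (hc.edist (continuous_const (y := hF.toLp (B.indicator f)))).tendsto 0
  have h0 : DomAddAct.mk (0 : Fin n → ℝ) = 0 := rfl
  simp only [h0, zero_vadd, edist_self] at ht
  have ht2 := (ENNReal.continuous_pow 2).tendsto 0 |>.comp ht
  simp only [ne_eq, OfNat.ofNat_ne_zero, not_false_eq_true, zero_pow] at ht2
  refine tendsto_of_tendsto_of_tendsto_of_le_of_le' tendsto_const_nhds ht2
    (Filter.Eventually.of_forall fun _ => zero_le) ?_
  filter_upwards [Metric.ball_mem_nhds (0 : Fin n → ℝ) one_pos] with ξ hξ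
  have hξ' : ‖ξ‖ < 1 := by simpa using hξ
  simp only [Function.comp]
  rw [DomAddAct.mk_vadd_toLp, Lp.edist_toLp_toLp,
    eLpNorm_eq_lintegral_rpow_enorm_toReal (by norm_num) (by norm_num)]
  simp only [ENNReal.toReal_ofNat, ENNReal.rpow_ofNat]
  rw [← ENNReal.rpow_natCast, ← ENNReal.rpow_mul]
  norm_num
  unfold μT
  rw [← lintegral_indicator measurableSet_box]
  refine lintegral_mono fun x => ?_
  refine Set.indicator_apply_le' (fun hx => ?_) fun _ => zero_le
  have hx : ∀ i, 0 ≤ x i ∧ x i < 1 := fun i => hx i trivial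
  have h1 : x ∈ B := fun i _ => ⟨by linarith [(hx i).1], by linarith [(hx i).2]⟩
  have h2 : x + ξ ∈ B := fun i _ => by
    have := abs_lt.1 ((norm_le_pi_norm ξ i).trans_lt hξ')
    constructor <;> simp only [Pi.add_apply] <;> linarith [(hx i).1, (hx i).2]
  simp only [add_comm ξ x, Set.indicator_of_mem h1, Set.indicator_of_mem h2, le_refl]

end Translation

section Modulus

variable {n : ℕ}

lemma Continuous.integrable_muT {f : (Fin n → ℝ) → ℝ} (hf : Continuous f) :
    Integrable f (μT n) := by
  have h : IntegrableOn f (Set.Icc 0 1) volume := hf.continuousOn.integrableOn_compact isCompact_Icc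
  exact h.mono_set fun x hx => ⟨fun i => (hx i trivial).1, fun i => (hx i trivial).2.le⟩

lemma lintegral_enorm_mul_enorm_pow {f g : (Fin n → ℝ) → ℝ} (hf : Continuous f) (hg : Continuous g)
    (p : ℕ) : ∫⁻ ξ, ‖f ξ‖ₑ * ‖g ξ‖ₑ ^ p ∂μT n =
      ENNReal.ofReal (∫ ξ, |f ξ| * |g ξ| ^ p ∂μT n) := by
  have h := ofReal_integral_norm_eq_lintegral_enorm
    (Continuous.integrable_muT (n := n) (hf.mul (hg.pow p)))
  simpa [enorm_mul, enorm_pow] using h.symm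

/-- A point of the torus has a representative dominated by `|sin (π ξ l)|`. -/
lemma exists_representative (ξ : Fin n → ℝ) :
    ∃ k : Fin n → ℤ, ∀ l, |(ξ + fun i => (k i : ℝ)) l| ≤ |Real.sin (Real.pi * ξ l)| := by
  refine ⟨fun i => -round (ξ i), fun l => ?_⟩
  set z : ℝ := ξ l - round (ξ l) with hz
  have h1 : |z| ≤ 1 / 2 := abs_sub_round _
  have h2 : 2 / Real.pi * |Real.pi * z| ≤ |Real.sin (Real.pi * z)| := by
    refine Real.mul_abs_le_abs_sin ?_
    rw [abs_mul, abs_of_pos Real.pi_pos]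
    nlinarith [Real.pi_pos]
  have h3 : |Real.sin (Real.pi * z)| = |Real.sin (Real.pi * ξ l)| := by
    rw [hz, mul_sub, mul_comm Real.pi (round (ξ l) : ℝ), Real.sin_sub_int_mul_pi, abs_mul,
      abs_zpow, abs_neg, abs_one, one_zpow, one_mul]
  rw [h3, abs_mul, abs_of_pos Real.pi_pos] at h2
  have h4 : 2 / Real.pi * (Real.pi * |z|) = 2 * |z| := by
    field_simp
  rw [h4] at h2
  have h5 : (ξ + fun i => ((-round (ξ i) : ℤ) : ℝ)) l = z := by
    simp [hz, sub_eq_add_neg]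
  rw [h5]
  linarith [abs_nonneg z]

lemma exists_le_add_mul_sin_sq {h : (Fin n → ℝ) → ℝ≥0∞} (hp : ZPeriodic h) {B : ℝ≥0∞}
    (hB : B < ∞) (hle : ∀ ξ, h ξ ≤ B) (h0 : Filter.Tendsto h (nhds 0) (nhds 0)) {δ : ℝ≥0∞}
    (hδ : 0 < δ) :
    ∃ C < ∞, ∀ ξ, h ξ ≤ δ + C * ∑ l, ‖Real.sin (Real.pi * ξ l)‖ₑ ^ 2 := by
  obtain ⟨r, hr, hball⟩ := Metric.eventually_nhds_iff.1 (ENNReal.tendsto_nhds_zero.1 h0 δ hδ)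
  refine ⟨B / ENNReal.ofReal (r ^ 2), ENNReal.div_lt_top hB.ne (by simpa using hr.ne'), fun ξ => ?_⟩
  obtain ⟨k, hk⟩ := exists_representative ξ
  rw [← hp ξ k]
  set ζ := ξ + fun i => (k i : ℝ)
  by_cases hζ : ‖ζ‖ < r
  · exact (hball (by simpa using hζ)).trans le_self_add
  · have : ∃ l, r ≤ |ζ l| := by
      by_contra hcon
      push Not at hcon
      exact hζ ((pi_norm_lt_iff hr).2 hcon)
    obtain ⟨l, hl⟩ := this
    have h1 : ENNReal.ofReal (r ^ 2) ≤ ‖Real.sin (Real.pi * ξ l)‖ₑ ^ 2 := by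
      rw [ENNReal.ofReal_pow hr.le, ← ofReal_norm, Real.norm_eq_abs]
      gcongr
      exact hl.trans (hk l)
    have h2 : ENNReal.ofReal (r ^ 2) ≤ ∑ l, ‖Real.sin (Real.pi * ξ l)‖ₑ ^ 2 :=
      h1.trans (Finset.single_le_sum (f := fun l => ‖Real.sin (Real.pi * ξ l)‖ₑ ^ 2)
        (fun _ _ => zero_le) (Finset.mem_univ l))
    calc h ζ ≤ B := hle ζ
      _ = B / ENNReal.ofReal (r ^ 2) * ENNReal.ofReal (r ^ 2) :=
          (ENNReal.div_mul_cancel (by simpa using hr.ne') ENNReal.ofReal_ne_top).symm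
      _ ≤ B / ENNReal.ofReal (r ^ 2) * ∑ l, ‖Real.sin (Real.pi * ξ l)‖ₑ ^ 2 := by gcongr
      _ ≤ _ := le_add_self

lemma exists_rpow_le {β δ : ℝ} (hβ : 1 < β) (hδ : 0 < δ) :
    ∃ C, 0 ≤ C ∧ ∀ s, 0 ≤ s → s ≤ 1 → s ^ β ≤ δ * s + C * s ^ 3 := by
  have ht : Filter.Tendsto (fun s : ℝ => s ^ (β - 1)) (nhds 0) (nhds 0) := by
    have := (Real.continuous_rpow_const (by linarith : 0 ≤ β - 1)).tendsto 0
    rwa [Real.zero_rpow (by linarith)] at this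
  obtain ⟨r, hr, hball⟩ := Metric.eventually_nhds_iff.1 (ht.eventually_le_const hδ)
  refine ⟨(r ^ 3)⁻¹, by positivity, fun s hs hs1 => ?_⟩
  by_cases hsr : s < r
  · have h1 : s ^ (β - 1) ≤ δ := hball (by simpa [abs_of_nonneg hs] using hsr)
    have h2 : s ^ β = s ^ (β - 1) * s := by
      rcases hs.eq_or_lt with rfl | hs0
      · rw [Real.zero_rpow (by linarith), mul_zero]
      · rw [← Real.rpow_add_one hs0.ne', sub_add_cancel]
    rw [h2]
    have : 0 ≤ (r ^ 3)⁻¹ * s ^ 3 := by positivity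
    linarith [mul_le_mul_of_nonneg_right h1 hs]
  · have h1 : s ^ β ≤ 1 := Real.rpow_le_one hs hs1 (by linarith)
    have h2 : 1 ≤ (r ^ 3)⁻¹ * s ^ 3 := by
      rw [inv_mul_eq_div, one_le_div (by positivity)]
      exact pow_le_pow_left₀ hr.le (not_lt.1 hsr) 3
    have : 0 ≤ δ * s := by positivity
    linarith

lemma exists_le_mul_sin_add_mul_sin_cube {D : (Fin n → ℝ) → ℝ≥0∞} (hp : ZPeriodic D) {M : ℝ≥0∞}
    {β δ : ℝ} (hβ : 1 < β) (h0 : D 0 = 0) (hle : ∀ ξ, ξ ≠ 0 → D ξ ≤ M * ENNReal.ofReal (‖ξ‖ ^ β))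
    (hδ : 0 < δ) :
    ∃ C < ∞, ∀ ξ, D ξ ≤ M * ∑ l, (ENNReal.ofReal δ * ‖Real.sin (Real.pi * ξ l)‖ₑ ^ 1 +
      C * ‖Real.sin (Real.pi * ξ l)‖ₑ ^ 3) := by
  obtain ⟨C, hC, hs⟩ := exists_rpow_le hβ hδ
  refine ⟨ENNReal.ofReal C, ENNReal.ofReal_lt_top, fun ξ => ?_⟩
  obtain ⟨k, hk⟩ := exists_representative ξ
  rw [← hp ξ k]
  set ζ := ξ + fun i => (k i : ℝ)
  by_cases hζ : ζ = 0
  · rw [hζ, h0]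
    exact zero_le
  · have : ∃ l, ‖ζ‖ ≤ |ζ l| := by
      by_contra hcon
      push Not at hcon
      exact lt_irrefl _ ((pi_norm_lt_iff (norm_pos_iff.2 hζ)).2 hcon)
    obtain ⟨l, hl⟩ := this
    have hl' : ‖ζ‖ ≤ |Real.sin (Real.pi * ξ l)| := hl.trans (hk l)
    refine (hle ζ hζ).trans ?_
    gcongr
    refine le_trans ?_ (Finset.single_le_sum
      (f := fun l => (ENNReal.ofReal δ * ‖Real.sin (Real.pi * ξ l)‖ₑ ^ 1 +
        ENNReal.ofReal C * ‖Real.sin (Real.pi * ξ l)‖ₑ ^ 3))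
        (fun _ _ => zero_le) (Finset.mem_univ l))
    have h1 : ‖ζ‖ ^ β ≤ δ * |Real.sin (Real.pi * ξ l)| + C * |Real.sin (Real.pi * ξ l)| ^ 3 :=
      (Real.rpow_le_rpow (norm_nonneg _) hl' (by linarith)).trans
        (hs _ (abs_nonneg _) (Real.abs_sin_le_one _))
    refine (ENNReal.ofReal_le_ofReal h1).trans ?_
    rw [ENNReal.ofReal_add (by positivity) (by positivity), ENNReal.ofReal_mul hδ.le,
      ENNReal.ofReal_mul hC, ENNReal.ofReal_pow (abs_nonneg _), ← Real.norm_eq_abs, ofReal_norm,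
      pow_one]

lemma tendsto_zero_of_le_add {f g : ℕ → ℝ≥0∞} {A : ℝ≥0∞} (hA : A ≠ ∞)
    (hg : Filter.Tendsto g Filter.atTop (nhds 0))
    (h : ∀ δ : ℝ, 0 < δ → ∃ C < ∞, ∀ m, f m ≤ A * ENNReal.ofReal δ + C * g m) :
    Filter.Tendsto f Filter.atTop (nhds 0) := by
  have h1 : ∀ δ : ℝ, 0 < δ → Filter.limsup f Filter.atTop ≤ A * ENNReal.ofReal δ := by
    intro δ hδ
    obtain ⟨C, hC, hle⟩ := h δ hδ
    have ht : Filter.Tendsto (fun m => A * ENNReal.ofReal δ + C * g m) Filter.atTop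
        (nhds (A * ENNReal.ofReal δ)) := by
      have := ENNReal.Tendsto.const_mul hg (Or.inr hC.ne)
      simpa using this.const_add (A * ENNReal.ofReal δ)
    exact (Filter.limsup_le_limsup (Filter.Eventually.of_forall hle)).trans ht.limsup_eq.le
  have h2 : Filter.Tendsto (fun δ : ℝ => A * ENNReal.ofReal δ) (nhdsWithin 0 (Set.Ioi 0))
      (nhds 0) := by
    have := ENNReal.Tendsto.const_mul (a := A) ((ENNReal.continuous_ofReal.tendsto 0).mono_left
      (nhdsWithin_le_nhds (s := Set.Ioi 0))) (Or.inr hA)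
    simpa using this
  have h3 : Filter.limsup f Filter.atTop ≤ 0 :=
    ge_of_tendsto h2 (by filter_upwards [self_mem_nhdsWithin] with δ hδ using h1 δ hδ)
  exact tendsto_of_le_liminf_of_limsup_le zero_le h3

end Modulus

section KernelLimits

variable {n : ℕ}

lemma contDiff_torusKernel (m : ℕ) : ContDiff ℝ (⊤ : ℕ∞) (torusKernel n m) := by
  refine Submodule.span_induction (p := fun K _ => ContDiff ℝ (⊤ : ℕ∞) K) ?_ contDiff_const
    (fun _ _ _ _ h1 h2 => h1.add h2) (fun c _ _ h => contDiff_const.smul h) (torusKernel_mem_span m)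
  rintro _ ⟨k, rfl⟩
  exact contDiff_mode k 0

lemma tendsto_lintegral_torusKernel_mul {h : (Fin n → ℝ) → ℝ≥0∞} (hp : ZPeriodic h) {B : ℝ≥0∞}
    (hB : B < ∞) (hle : ∀ ξ, h ξ ≤ B) (h0 : Filter.Tendsto h (nhds 0) (nhds 0)) :
    Filter.Tendsto (fun m => ∫⁻ ξ, ‖torusKernel n m ξ‖ₑ * h ξ ∂μT n) Filter.atTop (nhds 0) := by
  have hg : Filter.Tendsto (fun m : ℕ => (n : ℝ≥0∞) * ENNReal.ofReal (1 / (m + 1))) Filter.atTop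
      (nhds 0) := by
    have h1 := ENNReal.tendsto_ofReal (tendsto_one_div_add_atTop_nhds_zero_nat (𝕜 := ℝ))
    have := ENNReal.Tendsto.const_mul (a := (n : ℝ≥0∞)) h1 (Or.inr (ENNReal.natCast_ne_top n))
    simpa using this
  refine tendsto_zero_of_le_add (A := 1) (by simp) hg fun δ hδ => ?_
  obtain ⟨C, hC, hb⟩ := exists_le_add_mul_sin_sq hp hB hle h0 (ENNReal.ofReal_pos.2 hδ)
  refine ⟨C, hC, fun m => ?_⟩
  have hK : Continuous (torusKernel n m) := (contDiff_torusKernel m).continuous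
  have hone : ∫⁻ ξ, ‖torusKernel n m ξ‖ₑ ∂μT n = 1 := by
    rw [← ofReal_integral_norm_eq_lintegral_enorm hK.integrable_muT]
    simp only [Real.norm_of_nonneg (torusKernel_nonneg m _), integral_torusKernel,
      ENNReal.ofReal_one]
  calc ∫⁻ ξ, ‖torusKernel n m ξ‖ₑ * h ξ ∂μT n
      ≤ ∫⁻ ξ, ENNReal.ofReal δ * ‖torusKernel n m ξ‖ₑ +
          C * ∑ l, ‖torusKernel n m ξ‖ₑ * ‖Real.sin (Real.pi * ξ l)‖ₑ ^ 2 ∂μT n := by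
        refine lintegral_mono fun ξ => (mul_le_mul_right (hb ξ) _).trans_eq ?_
        rw [← Finset.mul_sum]
        ring
    _ = ENNReal.ofReal δ + C * ∑ l, ENNReal.ofReal
          (∫ ξ, |torusKernel n m ξ| * |Real.sin (Real.pi * ξ l)| ^ 2 ∂μT n) := by
        rw [lintegral_add_left (by fun_prop), lintegral_const_mul _ (by fun_prop), hone,
          lintegral_const_mul _ (by fun_prop), lintegral_finsetSum _ (by fun_prop), mul_one]
        congr 2
        exact Finset.sum_congr rfl fun l _ => lintegral_enorm_mul_enorm_pow hK (by fun_prop) 2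
    _ ≤ ENNReal.ofReal δ + C * ∑ _l : Fin n, ENNReal.ofReal (1 / (m + 1)) := by
        gcongr with l
        simp only [abs_of_nonneg (torusKernel_nonneg m _)]
        exact integral_torusKernel_mul_sin_sq_le m l
    _ = _ := by simp

lemma tendsto_lintegral_pd_torusKernel_mul {D : (Fin n → ℝ) → ℝ≥0∞} (hp : ZPeriodic D)
    {M : ℝ≥0∞} (hM : M < ∞) {β : ℝ} (hβ : 1 < β) (h0 : D 0 = 0)
    (hle : ∀ ξ, ξ ≠ 0 → D ξ ≤ M * ENNReal.ofReal (‖ξ‖ ^ β)) (j : Fin n) :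
    Filter.Tendsto (fun m => ∫⁻ ξ, ‖pd j (torusKernel n m) ξ‖ₑ * D ξ ∂μT n)
      Filter.atTop (nhds 0) := by
  have hg : Filter.Tendsto (fun m : ℕ => ENNReal.ofReal (3 * Real.pi / Real.sqrt (m + 1)))
      Filter.atTop (nhds 0) := by
    have h1 : Filter.Tendsto (fun m : ℕ => 3 * Real.pi / Real.sqrt (m + 1)) Filter.atTop
        (nhds 0) := by
      refine Filter.Tendsto.const_div_atTop ?_ _
      exact Real.tendsto_sqrt_atTop.comp
        (Filter.tendsto_atTop_add_const_right _ _ tendsto_natCast_atTop_atTop)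
    simpa using ENNReal.tendsto_ofReal h1
  refine tendsto_zero_of_le_add (A := M * n * ENNReal.ofReal (3 * Real.pi))
    (ENNReal.mul_ne_top (ENNReal.mul_ne_top hM.ne (ENNReal.natCast_ne_top n))
      ENNReal.ofReal_ne_top) hg fun δ hδ => ?_
  obtain ⟨C, hC, hb⟩ := exists_le_mul_sin_add_mul_sin_cube hp hβ h0 hle hδ
  refine ⟨M * n * C, ENNReal.mul_lt_top (ENNReal.mul_lt_top hM (ENNReal.natCast_lt_top n)) hC,
    fun m => ?_⟩
  have hK : Continuous (pd j (torusKernel n m)) := continuous_pd (contDiff_torusKernel m) j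
  calc ∫⁻ ξ, ‖pd j (torusKernel n m) ξ‖ₑ * D ξ ∂μT n
      ≤ ∫⁻ ξ, M * ∑ l, (ENNReal.ofReal δ *
            (‖pd j (torusKernel n m) ξ‖ₑ * ‖Real.sin (Real.pi * ξ l)‖ₑ ^ 1) +
          C * (‖pd j (torusKernel n m) ξ‖ₑ * ‖Real.sin (Real.pi * ξ l)‖ₑ ^ 3)) ∂μT n := by
        refine lintegral_mono fun ξ => (mul_le_mul_right (hb ξ) _).trans_eq ?_
        rw [mul_left_comm, Finset.mul_sum]
        congr 1
        exact Finset.sum_congr rfl fun l _ => by ring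
    _ = M * ∑ l, (ENNReal.ofReal δ * ENNReal.ofReal
            (∫ ξ, |pd j (torusKernel n m) ξ| * |Real.sin (Real.pi * ξ l)| ^ 1 ∂μT n) +
          C * ENNReal.ofReal
            (∫ ξ, |pd j (torusKernel n m) ξ| * |Real.sin (Real.pi * ξ l)| ^ 3 ∂μT n)) := by
        rw [lintegral_const_mul _ (by fun_prop), lintegral_finsetSum _ (by fun_prop)]
        congr 1
        refine Finset.sum_congr rfl fun l _ => ?_
        rw [lintegral_add_left (by fun_prop), lintegral_const_mul _ (by fun_prop),
          lintegral_const_mul _ (by fun_prop), lintegral_enorm_mul_enorm_pow hK (by fun_prop),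
          lintegral_enorm_mul_enorm_pow hK (by fun_prop)]
    _ ≤ M * ∑ _l : Fin n, (ENNReal.ofReal δ * ENNReal.ofReal (3 * Real.pi) +
          C * ENNReal.ofReal (3 * Real.pi / Real.sqrt (m + 1))) := by
        gcongr with l
        · simpa using integral_abs_pd_torusKernel_mul_sin_le m j l
        · exact integral_abs_pd_torusKernel_mul_sin_cube_le m j l
    _ = _ := by
        simp only [Finset.sum_const, Finset.card_univ, Fintype.card_fin, nsmul_eq_mul]
        ring

end KernelLimits

section Assembly

variable {n : ℕ} {T : ℝ} {u : ℝ → (Fin n → ℝ) → (Fin n → ℝ)} {u₀ : (Fin n → ℝ) → (Fin n → ℝ)}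

lemma lintegral_enorm_cube_eq {E : Type*} [NormedAddCommGroup E] (w : (Fin n → ℝ) → E) :
    ∫⁻ x, ‖w x‖ₑ ^ 3 ∂μT n = eLpNorm w 3 (μT n) ^ 3 := by
  rw [eLpNorm_eq_lintegral_rpow_enorm_toReal (by norm_num) (by norm_num), ← ENNReal.rpow_natCast,
    ← ENNReal.rpow_mul]
  norm_num

lemma lintegral_enorm_cube_le_besovNorm {E : Type*} [NormedAddCommGroup E] [NormedSpace ℝ E]
    (α : ℝ) (w : (Fin n → ℝ) → E) : ∫⁻ x, ‖w x‖ₑ ^ 3 ∂μT n ≤ besovNorm α 3 w ^ 3 := by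
  rw [lintegral_enorm_cube_eq]
  gcongr
  exact le_self_add

lemma lintegral_enorm_translate_cube_le_besovNorm {E : Type*} [NormedAddCommGroup E]
    [NormedSpace ℝ E] (α : ℝ) (w : (Fin n → ℝ) → E) {ξ : Fin n → ℝ} (hξ : ξ ≠ 0) :
    ∫⁻ x, ‖w (x + ξ) - w x‖ₑ ^ 3 ∂μT n ≤
      besovNorm α 3 w ^ 3 * ENNReal.ofReal (‖ξ‖ ^ (3 * α)) := by
  have hpos : 0 < ‖ξ‖ := norm_pos_iff.2 hξ
  have e : ENNReal.ofReal (‖ξ‖ ^ (3 * α)) = ENNReal.ofReal (‖ξ‖ ^ α) ^ 3 := by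
    rw [← ENNReal.ofReal_pow (by positivity), ← Real.rpow_natCast, ← Real.rpow_mul hpos.le]
    norm_num [mul_comm]
  rw [lintegral_enorm_cube_eq (fun x => w (x + ξ) - w x), e, ← mul_pow]
  gcongr
  have h : eLpNorm (fun x => w (x + ξ) - w x) 3 (μT n) / ENNReal.ofReal (‖ξ‖ ^ α) ≤
      besovNorm α 3 w :=
    (le_iSup (fun ξ : {ξ : Fin n → ℝ // ξ ≠ 0} =>
      eLpNorm (fun x => w (x + ξ.1) - w x) 3 (μT n) / ENNReal.ofReal (‖ξ.1‖ ^ α)) ⟨ξ, hξ⟩).trans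
      le_add_self
  refine (ENNReal.div_le_iff ?_ ENNReal.ofReal_ne_top).1 h
  simpa using Real.rpow_pos_of_pos hpos α

lemma integral_comp_sub_left_eq {K : (Fin n → ℝ) → ℝ} (hp : ZPeriodic K)
    (he : ∀ ξ, K (-ξ) = K ξ) (x : Fin n → ℝ) : ∫ y, K (x - y) ∂μT n = ∫ y, K y ∂μT n := by
  rw [← hp.integral_add_right (-x)]
  exact integral_congr_ae (Filter.Eventually.of_forall fun y => by
    change K (x - y) = K (y + -x)
    rw [← he (x - y), neg_sub, sub_eq_add_neg])

lemma EnergyBalanced.enorm_flux_le {K : (Fin n → ℝ) → ℝ} (h : EnergyBalanced T u u₀ K)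
    {f : (Fin n → ℝ) → (Fin n → ℝ)} (hf : Measurable f) (hfp : ZPeriodic f)
    (hf3 : ∫⁻ x, ‖f x‖ₑ ^ 3 ∂μT n < ∞)
    (hdiv : ∀ φ : (Fin n → ℝ) → ℝ, ContDiff ℝ (⊤ : ℕ∞) φ → ZPeriodic φ →
      ∫ x, (∑ i, f x i * pd i φ x) ∂μT n = 0) :
    ‖flux (fun j => pd j K) f‖ₑ ≤
      n * ∑ j, ∫⁻ ξ, ‖pd j K ξ‖ₑ * ∫⁻ x, ‖f (x + ξ) - f x‖ₑ ^ 3 ∂μT n ∂μT n := by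
  have hc : ∀ j, Continuous (pd j K) := continuous_pd h.contDiff
  have hper : ∀ j, ZPeriodic (pd j K) := h.zperiodic.pd
  obtain ⟨C, hC⟩ := ZPeriodic.exists_bound (K := fun ξ j => pd j K ξ)
    (fun x k => funext fun j => hper j x k) (continuous_pi hc)
  refine _root_.enorm_flux_le hc hC (fun j ξ => pd_neg h.contDiff h.even j ξ) hper h.integral_pd
    hf hfp hf3 fun x => ?_
  have hφ : ContDiff ℝ (⊤ : ℕ∞) fun y => K (x - y) :=
    h.contDiff.comp (contDiff_const.sub contDiff_id)
  have hφp : ZPeriodic fun y => K (x - y) := fun y k => by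
    have := h.zperiodic (x - (y + fun i => (k i : ℝ))) k
    simp only [← this]
    congr 1
    abel
  have := hdiv _ hφ hφp
  simp only [pd_comp_sub h.contDiff, mul_neg, Finset.sum_neg_distrib, integral_neg,
    neg_eq_zero] at this
  simpa only [mul_comm] using this

/-- The total flux is controlled by the space-time cubic modulus of continuity. -/
lemma lintegral_flux_le (hw : IsWeakSolutionHomEuler n T u u₀)
    (h3 : ∀ᵐ t ∂volume.restrict (Set.Ioo 0 T), ∫⁻ x, ‖u t x‖ₑ ^ 3 ∂μT n < ∞)
    {K : (Fin n → ℝ) → ℝ} (h : EnergyBalanced T u u₀ K) :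
    ∫⁻ t in Set.Ioo 0 T, ‖flux (fun j => pd j K) (u t)‖ₑ ≤ n * ∑ j, ∫⁻ ξ, ‖pd j K ξ‖ₑ *
      (∫⁻ t in Set.Ioo 0 T, ∫⁻ x, ‖u t (x + ξ) - u t x‖ₑ ^ 3 ∂μT n) ∂μT n := by
  have hc : ∀ j, Continuous (pd j K) := continuous_pd h.contDiff
  have hu := hw.u_meas
  have hm : Measurable fun p : (ℝ × (Fin n → ℝ)) × (Fin n → ℝ) =>
      ‖u p.1.1 (p.2 + p.1.2) - u p.1.1 p.2‖ₑ ^ 3 := by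
    have h1 : Measurable fun p : (ℝ × (Fin n → ℝ)) × (Fin n → ℝ) => u p.1.1 (p.2 + p.1.2) :=
      hu.comp (by fun_prop : Measurable fun p : (ℝ × (Fin n → ℝ)) × (Fin n → ℝ) =>
        (p.1.1, p.2 + p.1.2))
    have h2 : Measurable fun p : (ℝ × (Fin n → ℝ)) × (Fin n → ℝ) => u p.1.1 p.2 :=
      hu.comp (by fun_prop : Measurable fun p : (ℝ × (Fin n → ℝ)) × (Fin n → ℝ) => (p.1.1, p.2))
    fun_prop
  have hm2 : Measurable fun p : ℝ × (Fin n → ℝ) =>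
      ∫⁻ x, ‖u p.1 (x + p.2) - u p.1 x‖ₑ ^ 3 ∂μT n := hm.lintegral_prod_right'
  have hm3 : ∀ j, Measurable fun p : ℝ × (Fin n → ℝ) => ‖pd j K p.2‖ₑ *
      ∫⁻ x, ‖u p.1 (x + p.2) - u p.1 x‖ₑ ^ 3 ∂μT n := fun j =>
    Measurable.mul ((hc j).measurable.comp measurable_snd).enorm hm2
  calc ∫⁻ t in Set.Ioo 0 T, ‖flux (fun j => pd j K) (u t)‖ₑ
      ≤ ∫⁻ t in Set.Ioo 0 T, n * ∑ j, ∫⁻ ξ, ‖pd j K ξ‖ₑ *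
          ∫⁻ x, ‖u t (x + ξ) - u t x‖ₑ ^ 3 ∂μT n ∂μT n := by
        refine lintegral_mono_ae ?_
        filter_upwards [h3, hw.div_free] with t ht hdiv
        exact h.enorm_flux_le (hw.measurable_slice t) (hw.u_per t) ht hdiv
    _ = n * ∑ j, ∫⁻ t in Set.Ioo 0 T, ∫⁻ ξ, ‖pd j K ξ‖ₑ *
          ∫⁻ x, ‖u t (x + ξ) - u t x‖ₑ ^ 3 ∂μT n ∂μT n := by
        rw [lintegral_const_mul' _ _ (ENNReal.natCast_ne_top n),
          lintegral_finsetSum _ fun j _ => (hm3 j).lintegral_prod_right']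
    _ = _ := by
        congr 1
        refine Finset.sum_congr rfl fun j _ => ?_
        rw [lintegral_lintegral_swap (hm3 j).aemeasurable]
        refine lintegral_congr fun ξ => ?_
        exact lintegral_const_mul' _ _ enorm_ne_top

lemma tendsto_corr_torusKernel {f : (Fin n → ℝ) → (Fin n → ℝ)} (hf : Measurable f)
    (hfp : ZPeriodic f) (hf2 : ∫⁻ x, ‖f x‖ₑ ^ 2 ∂μT n < ∞)
    (hK : ∀ m, EnergyBalanced T u u₀ (torusKernel n m)) :
    Filter.Tendsto (fun m => corr (torusKernel n m) f) Filter.atTop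
      (nhds (∫ x, ∑ l, f x l ^ 2 ∂μT n)) := by
  rw [tendsto_iff_edist_tendsto_0]
  have hper : ZPeriodic fun ξ => ∫⁻ x, ‖f (x + ξ) - f x‖ₑ ^ 2 ∂μT n := fun ξ k => by
    simp only [← add_assoc, hfp _ k]
  have hle : ∀ ξ, ∫⁻ x, ‖f (x + ξ) - f x‖ₑ ^ 2 ∂μT n ≤ 4 * ∫⁻ x, ‖f x‖ₑ ^ 2 ∂μT n := fun ξ => by
    have e : ∫⁻ x, ‖f (x + ξ)‖ₑ ^ 2 ∂μT n = ∫⁻ x, ‖f x‖ₑ ^ 2 ∂μT n :=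
      ZPeriodic.lintegral_add_right (f := fun x => ‖f x‖ₑ ^ 2)
        (fun x k => by simp only [hfp x k]) ξ
    calc ∫⁻ x, ‖f (x + ξ) - f x‖ₑ ^ 2 ∂μT n
        ≤ ∫⁻ x, 2 * (‖f (x + ξ)‖ₑ ^ 2 + ‖f x‖ₑ ^ 2) ∂μT n := by
          refine lintegral_mono fun x => ?_
          refine (pow_le_pow_left' enorm_sub_le 2).trans ?_
          simp only [enorm_eq_nnnorm]
          exact_mod_cast add_sq_le (a := ‖f (x + ξ)‖₊) (b := ‖f x‖₊)
      _ = _ := by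
          rw [lintegral_const_mul' _ _ (by simp), lintegral_add_left (by fun_prop), e]
          ring
  have h := tendsto_lintegral_torusKernel_mul hper (ENNReal.mul_lt_top (by simp) hf2) hle
    (hfp.tendsto_lintegral_translate hf hf2)
  have h' := ENNReal.Tendsto.const_mul (a := (n : ℝ≥0∞)) h (Or.inr (ENNReal.natCast_ne_top n))
  rw [mul_zero] at h'
  refine tendsto_of_tendsto_of_tendsto_of_le_of_le tendsto_const_nhds h' (fun _ => zero_le)
    fun m => ?_
  have hb := hK m
  obtain ⟨C, hC⟩ := hb.zperiodic.exists_bound hb.contDiff.continuous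
  dsimp only
  rw [edist_comm, edist_eq_enorm_sub]
  exact enorm_sq_integral_sub_corr_le hb.contDiff.continuous hC hb.even hb.zperiodic
    (fun x => (integral_comp_sub_left_eq hb.zperiodic hb.even x).trans (integral_torusKernel m))
    hf hfp hf2

lemma IsWeakSolutionHomEuler.energy_eq (hw : IsWeakSolutionHomEuler n T u u₀) (hT : 0 < T)
    (hu₀ : ∫⁻ x, ‖u₀ x‖ₑ ^ 2 ∂μT n < ∞)
    (hu₀div : ∀ φ : (Fin n → ℝ) → ℝ, ContDiff ℝ (⊤ : ℕ∞) φ → ZPeriodic φ →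
      ∫ x in Box n, (∑ i, u₀ x i * pd i φ x) = 0)
    {α : ℝ} (hα : 1 / 3 < α)
    (hB : ∫⁻ t in Set.Ioo 0 T, besovNorm α 3 (u t) ^ 3 < ∞) :
    ∀ᵐ t ∂volume.restrict (Set.Ioo 0 T),
      ∫ x, ∑ i, u t x i ^ 2 ∂μT n = ∫ x, ∑ i, u₀ x i ^ 2 ∂μT n := by
  have hK : ∀ m, EnergyBalanced T u u₀ (torusKernel n m) := fun m =>
    hw.balanced_of_mem_span hT hu₀ hu₀div (torusKernel_mem_span m)
  have h3 : ∀ᵐ t ∂volume.restrict (Set.Ioo 0 T), ∫⁻ x, ‖u t x‖ₑ ^ 3 ∂μT n < ∞ := by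
    have hm : Measurable fun p : ℝ × (Fin n → ℝ) => ‖u p.1 p.2‖ₑ ^ 3 :=
      hw.u_meas.enorm.pow_const 3
    refine ae_lt_top hm.lintegral_prod_right' (lt_of_le_of_lt ?_ hB).ne
    exact lintegral_mono fun t => lintegral_enorm_cube_le_besovNorm α (u t)
  set D : (Fin n → ℝ) → ℝ≥0∞ := fun ξ =>
    ∫⁻ t in Set.Ioo 0 T, ∫⁻ x, ‖u t (x + ξ) - u t x‖ₑ ^ 3 ∂μT n with hD
  have hDp : ZPeriodic D := fun ξ k => by
    simp only [hD, ← add_assoc, hw.u_per _ _ k]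
  have hDle : ∀ ξ, ξ ≠ 0 → D ξ ≤
      (∫⁻ t in Set.Ioo 0 T, besovNorm α 3 (u t) ^ 3) * ENNReal.ofReal (‖ξ‖ ^ (3 * α)) :=
    fun ξ hξ => by
      rw [← lintegral_mul_const' _ _ ENNReal.ofReal_ne_top]
      exact lintegral_mono fun t => lintegral_enorm_translate_cube_le_besovNorm α (u t) hξ
  have hflux : Filter.Tendsto (fun m => ∫⁻ t in Set.Ioo 0 T,
      ‖flux (fun j => pd j (torusKernel n m)) (u t)‖ₑ) Filter.atTop (nhds 0) := by
    have h1 := tendsto_finsetSum Finset.univ fun j _ =>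
      tendsto_lintegral_pd_torusKernel_mul hDp hB (by linarith) (by simp [hD]) hDle j
    have h2 := ENNReal.Tendsto.const_mul (a := (n : ℝ≥0∞)) h1 (Or.inr (ENNReal.natCast_ne_top n))
    rw [Finset.sum_const_zero, mul_zero] at h2
    exact tendsto_of_tendsto_of_tendsto_of_le_of_le tendsto_const_nhds h2 (fun _ => zero_le)
      fun m => lintegral_flux_le hw h3 (hK m)
  filter_upwards [ae_all_iff.2 fun m => (hK m).balance, hw.ae_finite,
    ae_restrict_mem measurableSet_Ioo] with t hbal ht2 ht
  have h1 := tendsto_corr_torusKernel (hw.measurable_slice t) (hw.u_per t) ht2 hK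
  have h2 := tendsto_corr_torusKernel hw.u₀_meas hw.u₀_per hu₀ hK
  have hz : Filter.Tendsto (fun m => ∫ r in Set.Ioo 0 t,
      flux (fun j => pd j (torusKernel n m)) (u r)) Filter.atTop (nhds 0) := by
    rw [tendsto_iff_edist_tendsto_0]
    refine tendsto_of_tendsto_of_tendsto_of_le_of_le tendsto_const_nhds hflux (fun _ => zero_le)
      fun m => ?_
    dsimp only
    rw [edist_zero_right]
    exact (enorm_integral_le_lintegral_enorm _).trans
      (lintegral_mono_set (Set.Ioo_subset_Ioo_right ht.2.le))
  have h4 := h2.add (hz.const_mul 2)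
  rw [mul_zero, add_zero] at h4
  exact tendsto_nhds_unique (h1.congr hbal) h4

end Assembly

/-- **Energy conservation for the homogeneous Euler equations (Constantin–E–Titi,
recovered from the constant-density case of Theorem 1.1)**: if `u` is a weak solution
of the homogeneous incompressible Euler equations on `(0,T) × T^N` (`N = 2,3`) with
divergence-free initial datum `u₀ ∈ L²`, and
`u ∈ L^∞(0,T;L²(T^N)) ∩ L³(0,T;B^{α,∞}_3(T^N))` for some `α > 1/3`, then
`∫ |u(t)|² dx = ∫ |u₀|² dx` for a.e. `t ∈ (0,T)`. -/
theorem energy_conservation_homogeneous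
    (N : ℕ) (hN : N = 2 ∨ N = 3) (T : ℝ) (hT : 0 < T)
    (u : ℝ → (Fin N → ℝ) → (Fin N → ℝ)) (u₀ : (Fin N → ℝ) → (Fin N → ℝ))
    (hweak : IsWeakSolutionHomEuler N T u u₀)
    (hu₀L2 : eLpNorm u₀ 2 (μT N) < ∞)
    (hu₀div : ∀ φ : (Fin N → ℝ) → ℝ, ContDiff ℝ (⊤ : ℕ∞) φ → ZPeriodic φ →
      ∫ x in Box N, (∑ i, u₀ x i * pd i φ x) = 0)
    (α : ℝ) (hα : 1/3 < α) (hα1 : α < 1)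
    -- `u ∈ L^∞(0,T; L²(T^N))`:
    (huL2 : lpNormENN ∞ (volume.restrict (Set.Ioo 0 T))
      (fun t => eLpNorm (u t) 2 (μT N)) < ∞)
    -- `u ∈ L³(0,T; B^{α,∞}_3(T^N))`:
    (huB : lpNormENN 3 (volume.restrict (Set.Ioo 0 T))
      (fun t => besovNorm α 3 (u t)) < ∞) :
    ∀ᵐ t ∂(volume.restrict (Set.Ioo 0 T)),
      ∫ x in Box N, (∑ i, (u t x i)^2) = ∫ x in Box N, (∑ i, (u₀ x i)^2) := by
  have hu₀ : ∫⁻ x, ‖u₀ x‖ₑ ^ 2 ∂μT N < ∞ := by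
    rw [eLpNorm_lt_top_iff_lintegral_rpow_enorm_lt_top (by norm_num) (by norm_num)] at hu₀L2
    simpa using hu₀L2
  have hB : ∫⁻ t in Set.Ioo 0 T, besovNorm α 3 (u t) ^ 3 < ∞ := by
    rw [lpNormENN, if_neg (by norm_num), if_neg (by norm_num)] at huB
    simpa using (ENNReal.rpow_lt_top_iff_of_pos (by norm_num)).1 huB
  exact hweak.energy_eq hT hu₀ hu₀div hα hB
end
end

section
/- Let n ≥ 1, 0 < α < 1, and let 1 ≤ p, q ≤ ∞ satisfy 1/r = 1/p + 1/q ≤ 1. There exists a constant C > 0, independent of ε, f and g, such that for every f ∈ B^{α,∞}_p(T^n), every g ∈ L^q(T^n) and every ε > 0, the commutator satisfies ‖(fg)^ε − f g^ε‖_{L^r(T^n)} ≤ C ε^α ‖f‖_{B^{α,∞}_p(T^n)} ‖g‖_{L^q(T^n)}. In particular, if r < ∞ then (fg)^ε − f g^ε → 0 in L^r(T^n) as ε → 0. -/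
open MeasureTheory ENNReal
open scoped BigOperators

noncomputable section

/-- The `L^r` norm of a function dominated by averages over a probability measure. -/
theorem eLpNorm_le_of_enorm_le_lintegral {X Y : Type*} [MeasurableSpace X] [MeasurableSpace Y]
    {μ : Measure X} {ν : Measure Y} [SFinite μ] [IsProbabilityMeasure ν] {r : ℝ≥0∞} (hr : 1 ≤ r)
    {h : X → Y → ℝ} (hh : Measurable (Function.uncurry h)) {H : X → ℝ}
    (hH : ∀ x, ‖H x‖ₑ ≤ ∫⁻ y, ‖h x y‖ₑ ∂ν) {M : ℝ≥0∞}
    (hM : ∀ᵐ y ∂ν, eLpNorm (fun x => h x y) r μ ≤ M) : eLpNorm H r μ ≤ M := by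
  have hle : ∀ x, ‖H x‖ₑ ≤ eLpNorm (h x) r ν := fun x =>
    (hH x).trans <| by
      rw [← eLpNorm_one_eq_lintegral_enorm]
      exact eLpNorm_le_eLpNorm_of_exponent_le hr hh.of_uncurry_left.aestronglyMeasurable
  have hr0 : r ≠ 0 := (zero_lt_one.trans_le hr).ne'
  by_cases hrt : r = ∞
  · subst hrt
    have hae : ∀ᵐ x ∂μ, ∀ᵐ y ∂ν, ‖h x y‖ₑ ≤ M := by
      rw [Measure.ae_ae_comm (p := fun x y => ‖h x y‖ₑ ≤ M)
        (measurableSet_le hh.enorm measurable_const)]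
      filter_upwards [hM] with y hy
      rw [eLpNorm_exponent_top] at hy
      filter_upwards [enorm_ae_le_eLpNormEssSup (fun x => h x y) μ] with x hx using hx.trans hy
    rw [eLpNorm_exponent_top]
    refine essSup_le_of_ae_le _ ?_
    filter_upwards [hae] with x hx
    refine (hle x).trans ?_
    rw [eLpNorm_exponent_top]
    exact essSup_le_of_ae_le _ hx
  · have hrpos : 0 < r.toReal := ENNReal.toReal_pos hr0 hrt
    rw [eLpNorm_eq_lintegral_rpow_enorm_toReal hr0 hrt, one_div, ENNReal.rpow_inv_le_iff hrpos]
    calc ∫⁻ x, ‖H x‖ₑ ^ r.toReal ∂μ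
        ≤ ∫⁻ x, ∫⁻ y, ‖h x y‖ₑ ^ r.toReal ∂ν ∂μ := by
          refine lintegral_mono fun x => ?_
          have := hle x
          rwa [eLpNorm_eq_lintegral_rpow_enorm_toReal hr0 hrt, one_div,
            ENNReal.le_rpow_inv_iff hrpos] at this
      _ = ∫⁻ y, ∫⁻ x, ‖h x y‖ₑ ^ r.toReal ∂μ ∂ν :=
          lintegral_lintegral_swap (hh.enorm.pow_const _).aemeasurable
      _ ≤ ∫⁻ _, M ^ r.toReal ∂ν := by
          refine lintegral_mono_ae ?_
          filter_upwards [hM] with y hy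
          rwa [eLpNorm_eq_lintegral_rpow_enorm_toReal hr0 hrt, one_div,
            ENNReal.rpow_inv_le_iff hrpos] at hy
      _ = M ^ r.toReal := by simp

theorem Box_eq_fundamentalDomain (n : ℕ) :
    Box n = ZSpan.fundamentalDomain (Pi.basisFun ℝ (Fin n)) := by
  rw [ZSpan.fundamentalDomain_pi_basisFun]
  rfl

theorem volume_Box (n : ℕ) : volume (Box n) = 1 := by
  simp [Box, volume_pi_pi]

instance isProbabilityMeasure_μT (n : ℕ) : IsProbabilityMeasure (μT n) :=
  ⟨by simp [μT, volume_Box]⟩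

/-- Periodic functions are invariant under the lattice spanned by the standard basis. -/
theorem ZPeriodic.vadd {n : ℕ} {E : Type*} {f : (Fin n → ℝ) → E} (hf : ZPeriodic f)
    (v : Submodule.span ℤ (Set.range (Pi.basisFun ℝ (Fin n)))) (x : Fin n → ℝ) :
    f (v +ᵥ x) = f x := by
  have hv := ((Pi.basisFun ℝ (Fin n)).mem_span_iff_repr_mem ℤ _).1 v.2
  choose k hk using hv
  have : (v +ᵥ x : Fin n → ℝ) = x + fun i => (k i : ℝ) := by
    ext i
    have := hk i
    simp only [Pi.basisFun_repr, eq_intCast] at this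
    rw [Submodule.vadd_def]
    simp [this, add_comm]
  rw [this, hf]

open scoped Pointwise in
/-- The `L^q` norm of a periodic function is the same over every translate of the unit box. -/
theorem ZPeriodic.eLpNorm_restrict_vadd_Box {n : ℕ} {f : (Fin n → ℝ) → ℝ} (hf : ZPeriodic f)
    (q : ℝ≥0∞) (y : Fin n → ℝ) :
    eLpNorm f q (volume.restrict (y +ᵥ Box n)) = eLpNorm f q (μT n) := by
  have : VAddInvariantMeasure (Submodule.span ℤ (Set.range (Pi.basisFun ℝ (Fin n))))
      (Fin n → ℝ) volume :=
    inferInstanceAs <| VAddInvariantMeasure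
      (Submodule.span ℤ (Set.range (Pi.basisFun ℝ (Fin n)))).toAddSubgroup (Fin n → ℝ) volume
  have hD : IsAddFundamentalDomain (Submodule.span ℤ (Set.range (Pi.basisFun ℝ (Fin n))))
      (Box n) volume := by
    rw [Box_eq_fundamentalDomain]
    exact ZSpan.isAddFundamentalDomain _ _
  have hDy := hD.vadd_of_comm y
  rcases eq_or_ne q 0 with rfl | hq0
  · simp
  rcases eq_or_ne q ∞ with rfl | hqt
  · have hinv : ∀ (v : Submodule.span ℤ (Set.range (Pi.basisFun ℝ (Fin n)))) (x : Fin n → ℝ),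
        ‖f (v +ᵥ x)‖ₑ = ‖f x‖ₑ := fun v x => by rw [hf.vadd]
    simp only [eLpNorm_exponent_top, eLpNormEssSup, μT]
    rw [hDy.essSup_measure_restrict (f := fun x => ‖f x‖ₑ) hinv,
      hD.essSup_measure_restrict (f := fun x => ‖f x‖ₑ) hinv]
  · rw [eLpNorm_eq_lintegral_rpow_enorm_toReal hq0 hqt,
      eLpNorm_eq_lintegral_rpow_enorm_toReal hq0 hqt, μT,
      hDy.setLIntegral_eq hD (fun x => ‖f x‖ₑ ^ q.toReal) fun v x => by rw [hf.vadd]]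

open scoped Pointwise in
theorem ZPeriodic.eLpNorm_comp_sub {n : ℕ} {f : (Fin n → ℝ) → ℝ} (hf : ZPeriodic f)
    (q : ℝ≥0∞) (y : Fin n → ℝ) :
    eLpNorm (fun x => f (x - y)) q (μT n) = eLpNorm f q (μT n) := by
  have hmp : MeasurePreserving (MeasurableEquiv.subRight y)
      (volume : Measure (Fin n → ℝ)) volume := measurePreserving_sub_right volume y
  have hpre : MeasurableEquiv.subRight y ⁻¹' (-y +ᵥ Box n) = Box n := by
    ext x
    have hx : y + MeasurableEquiv.subRight y x = x := add_sub_cancel y x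
    simp [Set.mem_vadd_set_iff_neg_vadd_mem, hx]
  have hmp' := hmp.restrict_preimage_emb (MeasurableEquiv.measurableEmbedding _) (-y +ᵥ Box n)
  rw [hpre] at hmp'
  rw [← hf.eLpNorm_restrict_vadd_Box q (-y), ← hmp'.map_eq,
    (MeasurableEquiv.measurableEmbedding _).eLpNorm_map_measure]
  rfl

open scoped Pointwise in
theorem ZPeriodic.locallyIntegrable {n : ℕ} {f : (Fin n → ℝ) → ℝ} (hf : ZPeriodic f)
    (hfm : Measurable f) {q : ℝ≥0∞} (hq : 1 ≤ q) (hfq : eLpNorm f q (μT n) < ∞) :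
    LocallyIntegrable f volume := by
  intro x
  refine ⟨(x - fun _ => (2⁻¹ : ℝ)) +ᵥ Box n, ?_, ?_⟩
  · refine Filter.mem_of_superset (Metric.ball_mem_nhds x (by norm_num : (0 : ℝ) < 2⁻¹)) ?_
    intro z hz
    rw [Set.mem_vadd_set_iff_neg_vadd_mem]
    intro i _
    have h1 := (norm_le_pi_norm (z - x) i).trans_lt (mem_ball_iff_norm.1 hz)
    rw [Pi.sub_apply, Real.norm_eq_abs, abs_lt] at h1
    simp only [vadd_eq_add, neg_sub, Pi.add_apply, Pi.sub_apply, Set.mem_Ico]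
    constructor <;> linarith [h1.1, h1.2]
  · rw [IntegrableOn, ← memLp_one_iff_integrable]
    refine ⟨hfm.aestronglyMeasurable, ?_⟩
    rw [hf.eLpNorm_restrict_vadd_Box]
    exact (eLpNorm_le_eLpNorm_of_exponent_le hq hfm.aestronglyMeasurable).trans_lt hfq

theorem eLpNorm_increment_le_besovNorm {n : ℕ} {α : ℝ} (p : ℝ≥0∞) (f : (Fin n → ℝ) → ℝ)
    (y : Fin n → ℝ) :
    eLpNorm (fun x => f (x - y) - f x) p (μT n)
      ≤ ENNReal.ofReal (‖y‖ ^ α) * besovNorm α p f := by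
  rcases eq_or_ne y 0 with rfl | hy
  · simp
  have hpos : 0 < ‖y‖ ^ α := Real.rpow_pos_of_pos (norm_pos_iff.2 hy) α
  have h : eLpNorm (fun x => f (x + -y) - f x) p (μT n) / ENNReal.ofReal (‖-y‖ ^ α)
      ≤ besovNorm α p f :=
    (le_iSup (fun ξ : {ξ : Fin n → ℝ // ξ ≠ 0} => eLpNorm (fun x => f (x + ξ.1) - f x) p (μT n) /
      ENNReal.ofReal (‖ξ.1‖ ^ α)) ⟨-y, neg_ne_zero.2 hy⟩).trans le_add_self
  rw [norm_neg, ENNReal.div_le_iff (by simpa using hpos) ENNReal.ofReal_ne_top, mul_comm] at h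
  simpa only [sub_eq_add_neg] using h

section Kernel

variable {n : ℕ} {η : (Fin n → ℝ) → ℝ} {ε : ℝ}

/-- The rescaled mollifier `η_ε`. -/
def scaledKernel (η : (Fin n → ℝ) → ℝ) (ε : ℝ) (y : Fin n → ℝ) : ℝ :=
  (ε ^ n)⁻¹ * η (ε⁻¹ • y)

theorem IsMollifier.scaledKernel_continuous (hη : IsMollifier η) :
    Continuous (scaledKernel η ε) :=
  continuous_const.mul (hη.smooth.continuous.comp (continuous_const_smul _))

theorem IsMollifier.scaledKernel_nonneg (hη : IsMollifier η) (hε : 0 < ε) (y : Fin n → ℝ) :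
    0 ≤ scaledKernel η ε y :=
  mul_nonneg (by positivity) (hη.nonneg _)

theorem IsMollifier.scaledKernel_eq_zero (hη : IsMollifier η) (hε : 0 < ε) {y : Fin n → ℝ}
    (hy : ε < ‖y‖) : scaledKernel η ε y = 0 := by
  rw [scaledKernel, hη.supp, mul_zero]
  rw [norm_smul, norm_inv, Real.norm_of_nonneg hε.le, ← div_eq_inv_mul]
  exact (one_lt_div hε).2 hy

theorem IsMollifier.scaledKernel_hasCompactSupport (hη : IsMollifier η) (hε : 0 < ε) :
    HasCompactSupport (scaledKernel η ε) :=
  HasCompactSupport.intro (isCompact_closedBall 0 ε) fun y hy =>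
    hη.scaledKernel_eq_zero hε (by simpa using hy)

theorem IsMollifier.integral_scaledKernel (hη : IsMollifier η) (hε : 0 < ε) :
    ∫ y, scaledKernel η ε y = 1 := by
  simp only [scaledKernel]
  rw [integral_const_mul, Measure.integral_comp_inv_smul_of_nonneg _ _ hε.le, hη.integral_one]
  simp [hε.ne']

/-- The probability measure with density `η_ε`. -/
def kernelMeasure (η : (Fin n → ℝ) → ℝ) (ε : ℝ) : Measure (Fin n → ℝ) :=
  volume.withDensity fun y => ENNReal.ofReal (scaledKernel η ε y)

theorem IsMollifier.isProbabilityMeasure_kernelMeasure (hη : IsMollifier η) (hε : 0 < ε) :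
    IsProbabilityMeasure (kernelMeasure η ε) := by
  constructor
  rw [kernelMeasure, withDensity_apply _ MeasurableSet.univ, Measure.restrict_univ,
    ← ofReal_integral_eq_lintegral_ofReal
      (hη.scaledKernel_continuous.integrable_of_hasCompactSupport
        (hη.scaledKernel_hasCompactSupport hε))
      (Filter.Eventually.of_forall (hη.scaledKernel_nonneg hε)),
    hη.integral_scaledKernel hε, ENNReal.ofReal_one]

theorem IsMollifier.ae_kernelMeasure_norm_le (hη : IsMollifier η) (hε : 0 < ε) :
    ∀ᵐ y ∂kernelMeasure η ε, ‖y‖ ≤ ε := by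
  rw [kernelMeasure, ae_withDensity_iff hη.scaledKernel_continuous.measurable.ennreal_ofReal]
  refine Filter.Eventually.of_forall fun y hy => ?_
  by_contra! h
  exact hy (by rw [hη.scaledKernel_eq_zero hε h, ENNReal.ofReal_zero])

theorem IsMollifier.integrable_scaledKernel_mul (hη : IsMollifier η) (hε : 0 < ε)
    {f : (Fin n → ℝ) → ℝ} (hf : LocallyIntegrable f volume) (x : Fin n → ℝ) :
    Integrable (fun y => scaledKernel η ε y * f (x - y)) := by
  have hc : HasCompactSupport fun y => scaledKernel η ε (x - y) :=
    (hη.scaledKernel_hasCompactSupport hε).comp_homeomorph (Homeomorph.subLeft x)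
  have := (hf.integrable_smul_left_of_hasCompactSupport
    (hη.scaledKernel_continuous.comp (continuous_const.sub continuous_id)) hc).comp_sub_left x
  simpa using this

/-- Pointwise bound of the commutator by the average of `|f (x - y) - f x| |g (x - y)|`. -/
theorem IsMollifier.enorm_commutator_le (hη : IsMollifier η) (hε : 0 < ε)
    {f g : (Fin n → ℝ) → ℝ} (hfm : Measurable f) (hgm : Measurable g)
    (hg : LocallyIntegrable g volume)
    (hfg : LocallyIntegrable (fun y => f y * g y) volume) (x : Fin n → ℝ) :
    ‖mollify η ε (fun y => f y * g y) x - f x * mollify η ε g x‖ₑ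
      ≤ ∫⁻ y, ‖(f (x - y) - f x) * g (x - y)‖ₑ ∂kernelMeasure η ε := by
  have heq : mollify η ε (fun y => f y * g y) x - f x * mollify η ε g x
      = ∫ y, scaledKernel η ε y * ((f (x - y) - f x) * g (x - y)) := by
    have hmol : ∀ F : (Fin n → ℝ) → ℝ,
        mollify η ε F x = ∫ y, scaledKernel η ε y * F (x - y) := fun _ => rfl
    rw [hmol, hmol]
    rw [← integral_const_mul, ← integral_sub (hη.integrable_scaledKernel_mul hε hfg x)
      ((hη.integrable_scaledKernel_mul hε hg x).const_mul (f x))]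
    congr 1
    ext y
    ring
  rw [heq, kernelMeasure, lintegral_withDensity_eq_lintegral_mul _
    hη.scaledKernel_continuous.measurable.ennreal_ofReal (by fun_prop)]
  refine (enorm_integral_le_lintegral_enorm _).trans_eq (lintegral_congr fun y => ?_)
  rw [enorm_mul, Real.enorm_of_nonneg (hη.scaledKernel_nonneg hε y), Pi.mul_apply]

end Kernel

theorem commutator_eLpNorm_le {n : ℕ} {α : ℝ} (hα0 : 0 < α) {p q r : ℝ≥0∞} (hq : 1 ≤ q)
    (hr : 1 / r = 1 / p + 1 / q) (hr1 : 1 / p + 1 / q ≤ 1)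
    {η : (Fin n → ℝ) → ℝ} (hη : IsMollifier η) {f g : (Fin n → ℝ) → ℝ}
    (hfm : Measurable f) (hfp : ZPeriodic f) (hfB : besovNorm α p f < ∞)
    (hgm : Measurable g) (hgp : ZPeriodic g) (hgq : eLpNorm g q (μT n) < ∞)
    {ε : ℝ} (hε : 0 < ε) :
    eLpNorm (fun x => mollify η ε (fun y => f y * g y) x - f x * mollify η ε g x) r (μT n)
      ≤ ENNReal.ofReal (ε ^ α) * besovNorm α p f * eLpNorm g q (μT n) := by
  have hr1' : 1 ≤ r := by
    rw [← hr, one_div] at hr1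
    exact ENNReal.inv_le_one.1 hr1
  have : ENNReal.HolderTriple p q r := ⟨by simpa only [one_div] using hr.symm⟩
  have hfgp : ZPeriodic fun y => f y * g y := fun x k => by
    change f _ * g _ = f x * g x
    rw [hfp, hgp]
  have hfgr : eLpNorm (fun y => f y * g y) r (μT n) < ∞ :=
    (eLpNorm_smul_le_mul_eLpNorm (p := p) (q := q) hgm.aestronglyMeasurable
      hfm.aestronglyMeasurable).trans_lt
      (ENNReal.mul_lt_top (le_self_add.trans_lt hfB) hgq)
  have := hη.isProbabilityMeasure_kernelMeasure hε
  refine eLpNorm_le_of_enorm_le_lintegral (ν := kernelMeasure η ε) hr1'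
    (h := fun x y => (f (x - y) - f x) * g (x - y)) (by unfold Function.uncurry; fun_prop)
    (hη.enorm_commutator_le hε hfm hgm (hgp.locallyIntegrable hgm hq hgq)
      (hfgp.locallyIntegrable (hfm.mul hgm) hr1' hfgr)) ?_
  filter_upwards [hη.ae_kernelMeasure_norm_le hε] with y hy
  calc eLpNorm (fun x => (f (x - y) - f x) * g (x - y)) r (μT n)
      ≤ eLpNorm (fun x => f (x - y) - f x) p (μT n) * eLpNorm (fun x => g (x - y)) q (μT n) :=
        eLpNorm_smul_le_mul_eLpNorm (f := fun x => g (x - y)) (φ := fun x => f (x - y) - f x)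
          (hgm.comp (measurable_id.sub_const y)).aestronglyMeasurable
          (by fun_prop : Measurable fun x => f (x - y) - f x).aestronglyMeasurable
    _ ≤ ENNReal.ofReal (ε ^ α) * besovNorm α p f * eLpNorm g q (μT n) := by
        rw [hgp.eLpNorm_comp_sub]
        gcongr
        exact (eLpNorm_increment_le_besovNorm p f y).trans (by gcongr)

/-- **Commutator estimate in Besov spaces** (Lemma 2.2 of the paper):
for `f ∈ B^{α,∞}_p(T^n)` and `g ∈ L^q(T^n)`, with `1/r = 1/p + 1/q ≤ 1`,
`‖(fg)^ε − f g^ε‖_{L^r} ≤ C ε^α ‖f‖_{B^{α,∞}_p} ‖g‖_{L^q}`; in particular if `r < ∞`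
the commutator tends to `0` in `L^r` as `ε → 0`. -/
theorem besov_commutator_estimate
    (n : ℕ) (hn : 1 ≤ n) (α : ℝ) (hα0 : 0 < α) (hα1 : α < 1)
    (p q r : ℝ≥0∞) (hp : 1 ≤ p) (hq : 1 ≤ q)
    (hr : 1/r = 1/p + 1/q) (hr1 : 1/p + 1/q ≤ 1)
    (η : (Fin n → ℝ) → ℝ) (hη : IsMollifier η) :
    (∃ C : ℝ, 0 < C ∧
      ∀ (f g : (Fin n → ℝ) → ℝ),
        Measurable f → ZPeriodic f → besovNorm α p f < ∞ →
        Measurable g → ZPeriodic g → eLpNorm g q (μT n) < ∞ →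
        ∀ ε : ℝ, 0 < ε →
          eLpNorm (fun x => mollify η ε (fun y => f y * g y) x - f x * mollify η ε g x) r (μT n)
            ≤ ENNReal.ofReal (C * ε ^ α) * besovNorm α p f * eLpNorm g q (μT n)) ∧
    (r ≠ ∞ →
      ∀ (f g : (Fin n → ℝ) → ℝ),
        Measurable f → ZPeriodic f → besovNorm α p f < ∞ →
        Measurable g → ZPeriodic g → eLpNorm g q (μT n) < ∞ →
        Filter.Tendsto
          (fun ε : ℝ =>
            eLpNorm (fun x => mollify η ε (fun y => f y * g y) x - f x * mollify η ε g x) r (μT n))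
          (nhdsWithin 0 (Set.Ioi 0)) (nhds 0)) := by
  have key := fun (f g : (Fin n → ℝ) → ℝ) hfm hfp hfB hgm hgp hgq (ε : ℝ) hε =>
    commutator_eLpNorm_le (f := f) (g := g) (ε := ε) hα0 hq hr hr1 hη hfm hfp hfB hgm hgp hgq hε
  refine ⟨⟨1, one_pos, by simpa only [one_mul] using key⟩, ?_⟩
  intro _ f g hfm hfp hfB hgm hgp hgq
  have hlim : Filter.Tendsto
      (fun ε : ℝ => ENNReal.ofReal (ε ^ α) * besovNorm α p f * eLpNorm g q (μT n))
      (nhdsWithin 0 (Set.Ioi 0)) (nhds 0) := by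
    have h0 : Filter.Tendsto (fun ε : ℝ => ENNReal.ofReal (ε ^ α))
        (nhdsWithin 0 (Set.Ioi 0)) (nhds 0) := by
      have := (Real.continuousAt_rpow_const (0 : ℝ) α (Or.inr hα0.le)).tendsto
      rw [Real.zero_rpow hα0.ne'] at this
      simpa using ENNReal.tendsto_ofReal (this.mono_left nhdsWithin_le_nhds)
    have h1 := ENNReal.Tendsto.mul_const h0 (Or.inr hfB.ne)
    simpa using ENNReal.Tendsto.mul_const h1 (Or.inr hgq.ne)
  refine tendsto_of_tendsto_of_tendsto_of_le_of_le' tendsto_const_nhds hlim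
    (Filter.Eventually.of_forall fun _ => zero_le) ?_
  filter_upwards [self_mem_nhdsWithin] with ε hε using key f g hfm hfp hfB hgm hgp hgq ε hε
end
end
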